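/- arXiv:1706.00617 — 4 statements merged into one kernel-verified Lean document; each statement's English description precedes it below -/
import Mathlib

section
/- Let D be a semi-complete digraph, let c be a nonnegative integer, and let π be a vertex ordering of D of width at most c. If u, v ∈ V(D) satisfy π(u) < π(v) − 3c, then for every vertex ordering σ of D of width at most c one has σ(u) < σ(v). -/
open Finset

variable {V : Type*} [Fintype V] [DecidableEq V]

/-- The set of the first `i` vertices in the vertex ordering `π`. -/
def prefixSet (π : V ≃ Fin (Fintype.card V)) (i : ℕ) : Finset V :=
  Finset.univ.filter (fun v => (π v : ℕ) < i)

/-- The set of the last `n - i` vertices in the vertex ordering `π`. -/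
def suffixSet (π : V ≃ Fin (Fintype.card V)) (i : ℕ) : Finset V :=
  Finset.univ.filter (fun v => i ≤ (π v : ℕ))

/-- The cut at position `i`: the arcs from outside the length-`i` prefix into the prefix. -/
def cutFinset (E : V → V → Prop) [DecidableRel E]
    (π : V ≃ Fin (Fintype.card V)) (i : ℕ) : Finset (V × V) :=
  Finset.univ.filter (fun p : V × V => E p.1 p.2 ∧ i ≤ (π p.1 : ℕ) ∧ (π p.2 : ℕ) < i)

/-- The size of the cut at position `i`. -/
def cutSize (E : V → V → Prop) [DecidableRel E]
    (π : V ≃ Fin (Fintype.card V)) (i : ℕ) : ℕ :=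
  (cutFinset E π i).card

/-- The width of a vertex ordering. -/
def widthOf (E : V → V → Prop) [DecidableRel E] (π : V ≃ Fin (Fintype.card V)) : ℕ :=
  (Finset.range (Fintype.card V + 1)).sup (cutSize E π)

/-- The cutwidth of a digraph. -/
noncomputable def cutwidth (E : V → V → Prop) [DecidableRel E] : ℕ :=
  sInf {w | ∃ π : V ≃ Fin (Fintype.card V), widthOf E π = w}

/-- The OLA-cost of a vertex ordering. -/
def olaOf (E : V → V → Prop) [DecidableRel E] (π : V ≃ Fin (Fintype.card V)) : ℕ :=
  ∑ i ∈ Finset.range (Fintype.card V + 1), cutSize E π i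

/-- The OLA-cost of a digraph. -/
noncomputable def ola (E : V → V → Prop) [DecidableRel E] : ℕ :=
  sInf {w | ∃ π : V ≃ Fin (Fintype.card V), olaOf E π = w}

theorem cut_card_le (E : V → V → Prop) [DecidableRel E] (c : ℕ)
    (π : V ≃ Fin (Fintype.card V)) (hw : widthOf E π ≤ c) (i : ℕ)
    (hi : i ≤ Fintype.card V) : (cutFinset E π i).card ≤ c := by
  refine le_trans ?_ hw
  exact Finset.le_sup (f := cutSize E π) (Finset.mem_range.2 (Nat.lt_succ_of_le hi))

/-- In a semi-complete digraph with an ordering `π` of width at most `c`,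
if `u` is more than `3c` positions before `v` in `π`, then `u` precedes `v` in every
ordering of width at most `c`. -/
theorem far_apart_rigid (E : V → V → Prop) [DecidableRel E]
    (hirr : ∀ w : V, ¬ E w w)
    (hsc : ∀ u v : V, u ≠ v → E u v ∨ E v u)
    (c : ℕ) (π : V ≃ Fin (Fintype.card V)) (hw : widthOf E π ≤ c)
    (u v : V) (hfar : (π u : ℕ) + 3 * c < (π v : ℕ)) :
    ∀ σ : V ≃ Fin (Fintype.card V), widthOf E σ ≤ c → σ u < σ v := by
  intro σ hσ
  by_contra hlt
  have huv : u ≠ v := by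
    rintro rfl
    omega
  have hlt' : (σ v : ℕ) < (σ u : ℕ) := by
    have h1 : σ v ≤ σ u := not_lt.1 hlt
    have h2 : σ v ≠ σ u := fun h => huv (σ.injective h).symm
    exact Fin.lt_def.1 (lt_of_le_of_ne h1 h2)
  let A : Finset V := univ.filter (fun w => (π u : ℕ) < π w ∧ E w u)
  let B : Finset V := univ.filter (fun w => (π w : ℕ) < π v ∧ E v w)
  let S : Finset V := univ.filter (fun w => (π u : ℕ) < π w ∧ (π w : ℕ) ≤ π v)
  have hA : A.card ≤ c := by
    refine le_trans ?_ (cut_card_le E c π hw (π u + 1) (π u).2)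
    refine Finset.card_le_card_of_injOn (fun w => (w, u)) ?_ ?_
    · intro w hw
      simp [A, cutFinset] at hw ⊢
      exact ⟨hw.2, hw.1⟩
    · intro a _ b _ h
      exact congrArg Prod.fst h
  have hB : B.card ≤ c := by
    refine le_trans ?_ (cut_card_le E c π hw (π v) (π v).2.le)
    refine Finset.card_le_card_of_injOn (fun w => (v, w)) ?_ ?_
    · intro w hw
      simp [B, cutFinset] at hw ⊢
      exact ⟨hw.2, hw.1⟩
    · intro a _ b _ h
      exact congrArg Prod.snd h
  have hS : S.card = (π v : ℕ) - π u := by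
    have h : S.map π.toEmbedding = Finset.Ioc (π u) (π v) := by
      ext x
      simp only [S, Finset.mem_map_equiv, Finset.mem_filter, Finset.mem_univ, true_and,
        Equiv.apply_symm_apply, Finset.mem_Ioc]
      rfl
    rw [← Finset.card_map π.toEmbedding, h, Fin.card_Ioc]
  have hG : c + 1 ≤ (S \ (A ∪ B)).card := by
    have h1 := Finset.le_card_sdiff (A ∪ B) S
    have h2 := Finset.card_union_le A B
    omega
  have hcut := cut_card_le E c σ hσ (σ v + 1) (σ v).2
  have hle : (S \ (A ∪ B)).card ≤ (cutFinset E σ (σ v + 1)).card := by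
    refine Finset.card_le_card_of_injOn
      (fun w => if (σ w : ℕ) ≤ σ v then (u, w) else (w, v)) ?_ ?_
    · intro w hw
      simp [S, A, B] at hw
      obtain ⟨⟨h1, h2⟩, h3, h4⟩ := hw
      have hwu : u ≠ w := by
        rintro rfl
        exact lt_irrefl _ h1
      have hE1 : E u w := (hsc u w hwu).resolve_right (h3 h1)
      by_cases h : (σ w : ℕ) ≤ σ v
      · simp only [h, if_true, cutFinset, Finset.coe_filter, Set.mem_ofPred_eq,
          Finset.mem_univ, true_and]
        exact ⟨hE1, by omega, by omega⟩
      · have hwv : w ≠ v := by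
          rintro rfl
          exact h le_rfl
        have h5 : π w < π v := lt_of_le_of_ne h2 (fun e => hwv (π.injective e))
        simp only [h, if_false, cutFinset, Finset.coe_filter, Set.mem_ofPred_eq,
          Finset.mem_univ, true_and]
        exact ⟨(hsc w v hwv).resolve_right (h4 h5), by omega, by omega⟩
    · intro a ha b hb hab
      have key : ∀ w, w ∈ (S \ (A ∪ B)) → w ≠ u := by
        rintro w hw rfl
        simp [S] at hw
      have ha := key a ha
      have hb := key b hb
      dsimp only at hab
      split_ifs at hab <;> simp only [Prod.mk.injEq] at hab
      · exact hab.2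
      · exact absurd hab.1.symm hb
      · exact absurd hab.1 ha
      · exact hab.1
  omega
end

section
/- For every finite simple digraph D and every vertex ordering π of D, there exists a lean vertex ordering π* of D satisfying ctw(D, π*) ≤ ctw(D, π). -/
open Finset

variable {V : Type*} [Fintype V] [DecidableEq V]

/-- The arcs of a path given as a list of vertices. -/
def pathArcs (l : List V) : List (V × V) := l.zip l.tail

/-- `l` is a directed path (walk) from `u` to `v` in the digraph `E`. -/
def IsPath (E : V → V → Prop) (u v : V) (l : List V) : Prop :=
  l.head? = some u ∧ l.getLast? = some v ∧ List.Chain' E l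

/-- The minimum cut size over positions in `[a, b]`. -/
def minCut (E : V → V → Prop) [DecidableRel E] (π : V ≃ Fin (Fintype.card V))
    (a b : ℕ) (hab : a ≤ b) : ℕ :=
  (Finset.Icc a b).inf' (Finset.nonempty_Icc.mpr hab) (cutSize E π)

/-- An ordering is lean if for all `0 ≤ a ≤ b ≤ n`, the maximum size of a family of
pairwise arc-disjoint paths from the last `n − b` vertices to the first `a` vertices
equals the minimum cut size over positions in `[a, b]`. -/
def IsLean (E : V → V → Prop) [DecidableRel E] (π : V ≃ Fin (Fintype.card V)) : Prop :=
  ∀ (a b : ℕ) (hab : a ≤ b), b ≤ Fintype.card V →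
    IsGreatest {d : ℕ | ∃ P : Fin d → List V,
        (∀ i, ∃ s ∈ suffixSet π b, ∃ t ∈ prefixSet π a, IsPath E s t (P i)) ∧
        (∀ i j, i ≠ j → ∀ e : V × V, e ∈ pathArcs (P i) → e ∉ pathArcs (P j))}
      (minCut E π a b hab)


/-- Number of arcs of `F` entering `A`. -/
def dIn (F : Finset (V × V)) (A : Finset V) : ℕ :=
  (F.filter (fun e => e.1 ∉ A ∧ e.2 ∈ A)).card

theorem dIn_submod (F : Finset (V × V)) (A B : Finset V) :
    dIn F (A ∩ B) + dIn F (A ∪ B) ≤ dIn F A + dIn F B := by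
  unfold dIn
  simp only [Finset.card_filter]
  rw [← Finset.sum_add_distrib, ← Finset.sum_add_distrib]
  apply Finset.sum_le_sum
  intro e _
  by_cases h1 : e.1 ∈ A <;> by_cases h2 : e.1 ∈ B <;> by_cases h3 : e.2 ∈ A <;>
    by_cases h4 : e.2 ∈ B <;> simp [h1, h2, h3, h4]

theorem dIn_erase (F : Finset (V × V)) (A : Finset V) (v : V)
    (hA : v ∈ A) (h : ∀ e ∈ F, e.2 = v → e.1 ∉ A) :
    dIn F (A.erase v) + (F.filter (fun e => e.2 = v)).card
      ≤ dIn F A + (F.filter (fun e => e.1 = v)).card := by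
  unfold dIn
  simp only [Finset.card_filter]
  rw [← Finset.sum_add_distrib, ← Finset.sum_add_distrib]
  apply Finset.sum_le_sum
  intro e he
  have := h e he
  by_cases h1 : e.1 ∈ A <;> by_cases h2 : e.2 ∈ A <;> by_cases h3 : e.1 = v <;>
    by_cases h4 : e.2 = v <;> simp_all

/-- Moving tokens to `T`. -/
theorem token_walks {k : ℕ} (T : Finset V) : ∀ (m : ℕ) (F : Finset (V × V)) (s : Fin k → V),
    F.card = m →
    (∀ v, v ∉ T → (F.filter (fun e => e.2 = v)).card
        + (Finset.univ.filter (fun i => s i = v)).card ≤ (F.filter (fun e => e.1 = v)).card) →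
    ∃ P : Fin k → List V,
      (∀ i, (P i).head? = some (s i) ∧ (∃ t ∈ T, (P i).getLast? = some t) ∧
        ∀ e ∈ pathArcs (P i), e ∈ F) ∧
      (∀ i j, i ≠ j → ∀ e : V × V, e ∈ pathArcs (P i) → e ∉ pathArcs (P j)) := by
  intro m
  induction m with
  | zero =>
    intro F s hF h
    have hF' : F = ∅ := Finset.card_eq_zero.mp hF
    subst hF'
    refine ⟨fun i => [s i], fun i => ⟨rfl, ⟨s i, ?_, rfl⟩, by simp [pathArcs]⟩, by simp [pathArcs]⟩
    by_contra hi
    have := h _ hi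
    simp at this
    exact this (x := i) rfl
  | succ m ih =>
    intro F s hF h
    by_cases hall : ∀ i, s i ∈ T
    · exact ⟨fun i => [s i], fun i => ⟨rfl, ⟨s i, hall i, rfl⟩, by simp [pathArcs]⟩,
        by simp [pathArcs]⟩
    push Not at hall
    obtain ⟨i, hi⟩ := hall
    have hpos : 0 < (F.filter (fun e => e.1 = s i)).card := by
      have h1 := h _ hi
      have h2 : 0 < (Finset.univ.filter (fun j => s j = s i)).card :=
        Finset.card_pos.mpr ⟨i, by simp⟩
      omega
    obtain ⟨⟨v, w⟩, he⟩ := Finset.card_pos.mp hpos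
    obtain ⟨heF, hv⟩ := Finset.mem_filter.mp he
    simp only at hv
    subst hv
    obtain ⟨P, hP, hdis⟩ := ih (F.erase (s i, w)) (Function.update s i w)
      (by rw [Finset.card_erase_of_mem heF]; omega) (by
        intro x hx
        have hx' := h x hx
        have e1 : (F.filter (fun e => e.2 = x)).card =
            ((F.erase (s i, w)).filter (fun e => e.2 = x)).card + (if w = x then 1 else 0) := by
          conv_lhs => rw [← Finset.insert_erase heF]
          rw [Finset.filter_insert]
          split_ifs with hh
          · rw [Finset.card_insert_of_notMem (by simp)]
          · simp
        have e2 : (F.filter (fun e => e.1 = x)).card =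
            ((F.erase (s i, w)).filter (fun e => e.1 = x)).card + (if s i = x then 1 else 0) := by
          conv_lhs => rw [← Finset.insert_erase heF]
          rw [Finset.filter_insert]
          split_ifs with hh
          · rw [Finset.card_insert_of_notMem (by simp)]
          · simp
        have e3 : (Finset.univ.filter (fun j => s j = x)).card + (if w = x then 1 else 0)
            = (Finset.univ.filter (fun j => Function.update s i w j = x)).card
              + (if s i = x then 1 else 0) := by
          simp only [Finset.card_filter]
          rw [← Finset.add_sum_erase _ _ (Finset.mem_univ i),
            ← Finset.add_sum_erase _ (fun j => if Function.update s i w j = x then 1 else 0)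
              (Finset.mem_univ i)]
          have : ∑ j ∈ Finset.univ.erase i, (if Function.update s i w j = x then 1 else 0)
              = ∑ j ∈ Finset.univ.erase i, (if s j = x then 1 else 0) := by
            apply Finset.sum_congr rfl
            intro j hj
            rw [Function.update_of_ne (Finset.ne_of_mem_erase hj)]
          rw [this]
          simp only [Function.update_self]
          omega
        omega)
    have harcs : pathArcs (s i :: P i) = (s i, w) :: pathArcs (P i) := by
      have := (hP i).1
      rw [Function.update_self] at this
      cases hl : P i with
      | nil => rw [hl] at this; simp at this
      | cons y l => rw [hl] at this; simp at this; subst this; simp [pathArcs]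
    have hold : ∀ j, ∀ e ∈ pathArcs (P j), e ∈ F ∧ e ≠ (s i, w) := by
      intro j e he
      have := (hP j).2.2 e he
      rw [Finset.mem_erase] at this
      exact ⟨this.2, this.1⟩
    refine ⟨Function.update P i (s i :: P i), ?_, ?_⟩
    · intro j
      by_cases hj : j = i
      · subst hj
        rw [Function.update_self]
        refine ⟨rfl, ?_, ?_⟩
        · obtain ⟨t, ht, hl⟩ := (hP j).2.1
          refine ⟨t, ht, ?_⟩
          cases hq : P j with
          | nil => rw [hq] at hl; simp at hl
          | cons y l => rw [hq] at hl; rw [List.getLast?_cons_cons]; exact hl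
        · intro e he
          rw [harcs] at he
          rcases List.mem_cons.mp he with h' | h'
          · rw [h']; exact heF
          · exact (hold _ e h').1
      · rw [Function.update_of_ne hj]
        have := hP j
        rw [Function.update_of_ne hj] at this
        exact ⟨this.1, this.2.1, fun e he => (hold _ e he).1⟩
    · intro j l hjl e hej hel
      by_cases hj : j = i
      · subst hj
        rw [Function.update_self, harcs] at hej
        rw [Function.update_of_ne hjl.symm] at hel
        rcases List.mem_cons.mp hej with h' | h'
        · exact (hold _ e hel).2 h'
        · exact hdis _ _ hjl e h' hel
      · rw [Function.update_of_ne hj] at hej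
        by_cases hl : l = i
        · subst hl
          rw [Function.update_self, harcs] at hel
          rcases List.mem_cons.mp hel with h' | h'
          · exact (hold _ e hej).2 h'
          · exact hdis _ _ hjl e hej h'
        · rw [Function.update_of_ne hl] at hel
          exact hdis _ _ hjl e hej hel

/-- Directed arc version of Menger's theorem. -/
theorem menger_arcs {k : ℕ} (F₀ : Finset (V × V)) (S T : Finset V) (hST : Disjoint S T)
    (hcut : ∀ A, T ⊆ A → Disjoint S A → k ≤ dIn F₀ A) :
    ∃ P : Fin k → List V,
      (∀ i, (∃ s ∈ S, (P i).head? = some s) ∧ (∃ t ∈ T, (P i).getLast? = some t) ∧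
        ∀ e ∈ pathArcs (P i), e ∈ F₀) ∧
      (∀ i j, i ≠ j → ∀ e : V × V, e ∈ pathArcs (P i) → e ∉ pathArcs (P j)) := by
  classical
  obtain ⟨F, hFm, hmin⟩ := Finset.exists_min_image
    (F₀.powerset.filter (fun F => ∀ A, T ⊆ A → Disjoint S A → k ≤ dIn F A)) Finset.card
    ⟨F₀, by simpa using hcut⟩
  obtain ⟨hFs, hF⟩ := Finset.mem_filter.mp hFm
  rw [Finset.mem_powerset] at hFs
  have htight : ∀ e ∈ F, ∃ A, T ⊆ A ∧ Disjoint S A ∧ dIn F A = k ∧ e.1 ∉ A ∧ e.2 ∈ A := by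
    intro e he
    by_contra hcon
    push Not at hcon
    have hmem : F.erase e ∈
        F₀.powerset.filter (fun F => ∀ A, T ⊆ A → Disjoint S A → k ≤ dIn F A) := by
      rw [Finset.mem_filter, Finset.mem_powerset]
      refine ⟨(Finset.erase_subset _ _).trans hFs, ?_⟩
      intro A hTA hSA
      have h1 := hF A hTA hSA
      unfold dIn at h1 ⊢
      rw [Finset.filter_erase]
      by_cases hent : e.1 ∉ A ∧ e.2 ∈ A
      · have h2 : dIn F A ≠ k := fun hk => hcon A hTA hSA hk hent.1 hent.2
        unfold dIn at h2
        rw [Finset.card_erase_of_mem (by simp [he, hent])]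
        omega
      · rw [Finset.erase_eq_of_notMem (by simp only [Finset.mem_filter]; tauto)]
        exact h1
    have := hmin _ hmem
    rw [Finset.card_erase_of_mem he] at this
    have := Finset.card_pos.mpr ⟨e, he⟩
    omega
  have hbal : ∀ v, v ∉ T → (F.filter (fun e => e.2 = v)).card ≤
      (F.filter (fun e => e.1 = v)).card := by
    intro v hvT
    by_cases hex : ∃ e ∈ F, e.2 = v
    swap
    · push Not at hex
      rw [Finset.filter_false_of_mem hex]
      simp
    obtain ⟨e, he, rfl⟩ := hex
    obtain ⟨A₁, h1, h2, h3, h4, h5⟩ := htight e he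
    obtain ⟨A, hAm, hAmin⟩ := Finset.exists_min_image
      (Finset.univ.filter (fun A => T ⊆ A ∧ Disjoint S A ∧ dIn F A = k ∧ e.2 ∈ A)) Finset.card
      ⟨A₁, by simp [h1, h2, h3, h5]⟩
    obtain ⟨-, hTA, hSA, hAk, heA⟩ := Finset.mem_filter.mp hAm
    have hlow : ∀ e' ∈ F, e'.2 = e.2 → e'.1 ∉ A := by
      intro e' he' hee hin
      obtain ⟨B, g1, g2, g3, g4, g5⟩ := htight e' he'
      have hsub := dIn_submod F A B
      have hi := hF (A ∩ B) (Finset.subset_inter hTA g1) (hSA.mono_right Finset.inter_subset_left)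
      have hu := hF (A ∪ B) (hTA.trans Finset.subset_union_left)
        (Finset.disjoint_union_right.mpr ⟨hSA, g2⟩)
      have hm := hAmin (A ∩ B) (by
        simp only [Finset.mem_filter, Finset.mem_univ, true_and]
        exact ⟨Finset.subset_inter hTA g1, hSA.mono_right Finset.inter_subset_left, by omega,
          Finset.mem_inter.mpr ⟨heA, hee ▸ g5⟩⟩)
      have heq := Finset.eq_of_subset_of_card_le (Finset.inter_subset_left (s₁ := A) (s₂ := B)) hm
      rw [← heq] at hin
      exact g4 (Finset.mem_inter.mp hin).2
    have hde := dIn_erase F A e.2 heA hlow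
    have := hF (A.erase e.2) (fun x hx => Finset.mem_erase.mpr
      ⟨fun hh => hvT (hh ▸ hx), hTA hx⟩) (hSA.mono_right (Finset.erase_subset _ _))
    omega
  have hSin : ∀ e ∈ F, e.2 ∉ S := by
    intro e he hS
    obtain ⟨A, h1, h2, h3, h4, h5⟩ := htight e he
    exact Finset.disjoint_left.mp h2 hS h5
  have hk := hF Sᶜ (fun x hx => Finset.mem_compl.mpr fun h => Finset.disjoint_left.mp hST h hx)
    disjoint_compl_right
  unfold dIn at hk
  obtain ⟨f⟩ : Nonempty (Fin k ↪ (F.filter (fun e => e.1 ∉ Sᶜ ∧ e.2 ∈ Sᶜ) : Finset (V × V))) := by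
    apply Function.Embedding.nonempty_of_card_le
    rw [Fintype.card_fin, Fintype.card_coe]
    exact hk
  have hfm : ∀ i, (f i).1 ∈ F ∧ (f i).1.1 ∈ S := by
    intro i
    have := (f i).2
    simp only [Finset.mem_filter, Finset.mem_compl, not_not] at this
    exact ⟨this.1, this.2.1⟩
  obtain ⟨P, hP, hdis⟩ := token_walks T F.card F (fun i => (f i).1.1) rfl (by
    intro v hv
    by_cases hvS : v ∈ S
    · rw [Finset.filter_false_of_mem (s := F) (p := fun e => e.2 = v)
        (fun e he hh => hSin e he (hh ▸ hvS))]
      rw [Finset.card_empty, zero_add]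
      apply Finset.card_le_card_of_injOn (fun i => (f i).1)
      · intro i hi
        simp at hi
        simp [hi, (hfm i).1]
      · intro i _ j _ hij
        exact f.injective (Subtype.ext hij)
    · rw [Finset.filter_false_of_mem (s := Finset.univ) (p := fun i => (f i).1.1 = v)
        (fun i _ hh => hvS (hh ▸ (hfm i).2))]
      rw [Finset.card_empty, add_zero]
      exact hbal v hv)
  exact ⟨P, fun i => ⟨⟨_, (hfm i).2, (hP i).1⟩, (hP i).2.1, fun e he => hFs ((hP i).2.2 e he)⟩, hdis⟩

theorem isChain_of_pathArcs (E : V → V → Prop) : ∀ l : List V,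
    (∀ e ∈ pathArcs l, E e.1 e.2) → List.IsChain E l
  | [], _ => by simp
  | [x], _ => by simp
  | x :: y :: l, h => by
    rw [List.isChain_cons_cons]
    refine ⟨h (x, y) (by simp [pathArcs]), isChain_of_pathArcs E (y :: l) fun e he => h e ?_⟩
    simp only [pathArcs, List.tail_cons, List.zip_cons_cons, List.mem_cons] at he ⊢
    exact Or.inr he

theorem exists_crossing (E : V → V → Prop) (A : Finset V) : ∀ (l : List V) (s t : V),
    IsPath E s t l → s ∉ A → t ∈ A → ∃ e ∈ pathArcs l, E e.1 e.2 ∧ e.1 ∉ A ∧ e.2 ∈ A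
  | [], s, t, h, _, _ => by simp [IsPath] at h
  | [x], s, t, h, hs, ht => by
    obtain ⟨h1, h2, -⟩ := h
    simp at h1 h2
    subst h1; subst h2
    exact absurd ht hs
  | x :: y :: l, s, t, h, hs, ht => by
    obtain ⟨h1, h2, h3⟩ := h
    simp only [List.head?_cons, Option.some.injEq] at h1
    subst h1
    have h3' : E x y ∧ List.IsChain E (y :: l) := List.isChain_cons_cons.mp h3
    by_cases hy : y ∈ A
    · exact ⟨(x, y), by simp [pathArcs], h3'.1, hs, hy⟩
    · obtain ⟨e, he, h'⟩ := exists_crossing E A (y :: l) y t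
        ⟨rfl, by rwa [List.getLast?_cons_cons] at h2, h3'.2⟩ hy ht
      refine ⟨e, ?_, h'⟩
      simp only [pathArcs, List.tail_cons, List.zip_cons_cons, List.mem_cons] at he ⊢
      exact Or.inr he

/-- The arc set. -/
def arcSet (E : V → V → Prop) [DecidableRel E] : Finset (V × V) :=
  Finset.univ.filter (fun p => E p.1 p.2)

theorem cutSize_eq (E : V → V → Prop) [DecidableRel E] (π : V ≃ Fin (Fintype.card V)) (i : ℕ) :
    cutSize E π i = dIn (arcSet E) (prefixSet π i) := by
  unfold cutSize dIn cutFinset arcSet prefixSet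
  rw [Finset.filter_filter]
  simp

theorem cutSize_zero (E : V → V → Prop) [DecidableRel E] (π : V ≃ Fin (Fintype.card V)) :
    cutSize E π 0 = 0 := by
  simp [cutSize, cutFinset]

theorem olaOf_eq (E : V → V → Prop) [DecidableRel E] (π : V ≃ Fin (Fintype.card V)) :
    olaOf E π = ∑ v, cutSize E π (π v + 1) := by
  unfold olaOf
  rw [Finset.sum_range_succ', cutSize_zero, add_zero, Finset.sum_range,
    ← Equiv.sum_comp π (fun i => cutSize E π (i + 1))]

theorem widthOf_le (E : V → V → Prop) [DecidableRel E] (π π' : V ≃ Fin (Fintype.card V))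
    (h : ∀ v, cutSize E π' (π' v + 1) ≤ cutSize E π (π v + 1)) : widthOf E π' ≤ widthOf E π := by
  unfold widthOf
  apply Finset.sup_le
  intro i hi
  rw [Finset.mem_range] at hi
  rcases i with _ | i
  · rw [cutSize_zero]; exact Nat.zero_le _
  · have h1 := h (π'.symm ⟨i, by omega⟩)
    rw [Equiv.apply_symm_apply] at h1
    refine h1.trans (Finset.le_sup (f := cutSize E π) ?_)
    have := (π (π'.symm ⟨i, by omega⟩)).2
    rw [Finset.mem_range]
    omega

theorem exists_order_of_key (key : V → ℕ) (hk : Function.Injective key) :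
    ∃ π' : V ≃ Fin (Fintype.card V), ∀ u v, π' u ≤ π' v ↔ key u ≤ key v := by
  have hlt : ∀ u v, key u < key v → (Finset.univ.filter (fun w => key w < key u)).card <
      (Finset.univ.filter (fun w => key w < key v)).card := by
    intro u v huv
    apply Finset.card_lt_card
    rw [Finset.ssubset_iff_of_subset]
    · exact ⟨u, by simpa using huv, by simp⟩
    · intro w hw
      simp at hw ⊢
      omega
  let f : V → Fin (Fintype.card V) := fun v =>
    ⟨(Finset.univ.filter (fun w => key w < key v)).card, by
      rw [← Finset.card_univ]
      apply Finset.card_lt_card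
      rw [Finset.ssubset_iff_of_subset (Finset.subset_univ _)]
      exact ⟨v, by simp, by simp⟩⟩
  have hfi : ∀ u v, key u < key v → f u < f v := fun u v h => hlt u v h
  have hinj : Function.Injective f := by
    intro u v huv
    rcases lt_trichotomy (key u) (key v) with h | h | h
    · exact absurd huv (hfi _ _ h).ne
    · exact hk h
    · exact absurd huv (hfi _ _ h).ne'
  refine ⟨Equiv.ofBijective f ((Fintype.bijective_iff_injective_and_card f).mpr
    ⟨hinj, by simp⟩), ?_⟩
  intro u v
  simp only [Equiv.ofBijective_apply]
  constructor
  · intro h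
    by_contra hc
    exact absurd (hfi v u (not_le.mp hc)) (not_lt.mpr h)
  · intro h
    rcases h.lt_or_eq with h | h
    · exact (hfi _ _ h).le
    · rw [hk h]

theorem rearrange (E : V → V → Prop) [DecidableRel E] (π : V ≃ Fin (Fintype.card V))
    (a b : ℕ) (hab : a ≤ b) (A : Finset V) (haA : prefixSet π a ⊆ A) (hAb : A ⊆ prefixSet π b)
    (hmin : ∀ B, prefixSet π a ⊆ B → B ⊆ prefixSet π b → dIn (arcSet E) A ≤ dIn (arcSet E) B)
    (hlt : ∀ i, a ≤ i → i ≤ b → dIn (arcSet E) A < cutSize E π i) :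
    ∃ π' : V ≃ Fin (Fintype.card V), olaOf E π' < olaOf E π ∧ widthOf E π' ≤ widthOf E π := by
  have hmem : ∀ i v, v ∈ prefixSet π i ↔ (π v : ℕ) < i := by
    intro i v; simp [prefixSet]
  obtain ⟨π', hπ'⟩ := exists_order_of_key
    (fun v => if v ∈ A then (π v : ℕ) else Fintype.card V + π v) (by
      intro u v huv
      have h1 := (π u).2
      have h2 := (π v).2
      apply π.injective
      apply Fin.ext
      simp only at huv
      split_ifs at huv <;> omega)
  have hpre : ∀ v u, u ∈ prefixSet π' (π' v + 1) ↔
      (if u ∈ A then (π u : ℕ) else Fintype.card V + π u) ≤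
      (if v ∈ A then (π v : ℕ) else Fintype.card V + π v) := by
    intro v u
    rw [← hπ' u v]
    simp [prefixSet, Nat.lt_succ_iff]
  have hin : ∀ v ∈ A, prefixSet π' (π' v + 1) = prefixSet π (π v + 1) ∩ A := by
    intro v hv
    ext u
    have h1 := (π u).2
    have h2 := (π v).2
    rw [hpre, Finset.mem_inter, hmem]
    simp only [hv, if_true]
    split_ifs with h <;> simp only [h, and_true, and_false, iff_false] <;> omega
  have hout : ∀ v, v ∉ A → prefixSet π' (π' v + 1) = prefixSet π (π v + 1) ∪ A := by
    intro v hv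
    ext u
    have h1 := (π u).2
    have h2 := (π v).2
    rw [hpre, Finset.mem_union, hmem]
    simp only [hv, if_false]
    split_ifs with h <;> simp only [h, or_true, or_false, iff_true] <;> omega
  have hle : ∀ v, cutSize E π' (π' v + 1) ≤ cutSize E π (π v + 1) := by
    intro v
    rw [cutSize_eq, cutSize_eq]
    have hs := dIn_submod (arcSet E) (prefixSet π (π v + 1)) A
    by_cases hv : v ∈ A
    · rw [hin v hv]
      have hvb := (hmem _ _).mp (hAb hv)
      have := hmin (prefixSet π (π v + 1) ∪ A) (haA.trans Finset.subset_union_right)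
        (Finset.union_subset (fun u hu => by rw [hmem] at hu ⊢; omega) hAb)
      omega
    · rw [hout v hv]
      have hva : ¬ (π v : ℕ) < a := fun h => hv (haA ((hmem _ _).mpr h))
      have := hmin (prefixSet π (π v + 1) ∩ A)
        (Finset.subset_inter (fun u hu => by rw [hmem] at hu ⊢; omega) haA)
        (Finset.inter_subset_right.trans hAb)
      omega
  have hne : A ≠ prefixSet π a := by
    intro h
    have := hlt a le_rfl hab
    rw [cutSize_eq, ← h] at this
    exact lt_irrefl _ this
  have hAne : A.Nonempty := by
    rw [Finset.nonempty_iff_ne_empty]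
    intro h
    apply hne
    rw [h] at haA ⊢
    exact (Finset.subset_empty.mp haA).symm
  obtain ⟨v, hv, hvmax⟩ := Finset.exists_max_image A (fun u => (π u : ℕ)) hAne
  have hAsub : A ⊆ prefixSet π (π v + 1) := fun u hu => by
    have := hvmax u hu
    rw [hmem]; omega
  refine ⟨π', ?_, widthOf_le E π π' hle⟩
  rw [olaOf_eq, olaOf_eq]
  refine Finset.sum_lt_sum (fun v _ => hle v) ⟨v, Finset.mem_univ _, ?_⟩
  rw [cutSize_eq E π', hin v hv, Finset.inter_eq_right.mpr hAsub]
  apply hlt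
  · by_contra hc
    apply hne
    refine Finset.Subset.antisymm (fun u hu => ?_) haA
    have := (hmem _ _).mp (hAsub hu)
    rw [hmem]; omega
  · exact (hmem _ _).mp (hAb hv)

/-- Every ordering of a finite simple digraph can be turned into a
lean ordering without increasing the width. -/
theorem exists_lean_ordering (E : V → V → Prop) [DecidableRel E]
    (hirr : ∀ v : V, ¬ E v v)
    (π : V ≃ Fin (Fintype.card V)) :
    ∃ πs : V ≃ Fin (Fintype.card V), IsLean E πs ∧ widthOf E πs ≤ widthOf E π := by
  obtain ⟨σ, hσm, hσmin⟩ := Finset.exists_min_image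
    (Finset.univ.filter (fun σ : V ≃ Fin (Fintype.card V) => widthOf E σ ≤ widthOf E π))
    (olaOf E) ⟨π, by simp⟩
  have hσw := (Finset.mem_filter.mp hσm).2
  refine ⟨σ, ?_, hσw⟩
  intro a b hab hb
  have hmemp : ∀ i v, v ∈ prefixSet σ i ↔ (σ v : ℕ) < i := by
    intro i v; simp [prefixSet]
  have hmems : ∀ i v, v ∈ suffixSet σ i ↔ i ≤ (σ v : ℕ) := by
    intro i v; simp [suffixSet]
  constructor
  · have hcut : ∀ A, prefixSet σ a ⊆ A → Disjoint (suffixSet σ b) A →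
        minCut E σ a b hab ≤ dIn (arcSet E) A := by
      intro A' hTA hSA
      have hA'b : A' ⊆ prefixSet σ b := by
        intro u hu
        rw [hmemp]
        by_contra hc
        exact Finset.disjoint_left.mp hSA ((hmems _ _).mpr (not_lt.mp hc)) hu
      by_contra hcon
      push Not at hcon
      obtain ⟨A, hAm, hAmin⟩ := Finset.exists_min_image
        (Finset.univ.filter (fun A => prefixSet σ a ⊆ A ∧ A ⊆ prefixSet σ b)) (dIn (arcSet E))
        ⟨A', by simp [hTA, hA'b]⟩
      obtain ⟨-, hA1, hA2⟩ := Finset.mem_filter.mp hAm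
      have hAA' := hAmin A' (by simp [hTA, hA'b])
      obtain ⟨π', h1, h2⟩ := rearrange E σ a b hab A hA1 hA2
        (fun B hB1 hB2 => hAmin B (by simp [hB1, hB2]))
        (fun i hi1 hi2 => by
          have : minCut E σ a b hab ≤ cutSize E σ i :=
            Finset.inf'_le _ (Finset.mem_Icc.mpr ⟨hi1, hi2⟩)
          omega)
      have := hσmin π' (by simpa using h2.trans hσw)
      omega
    obtain ⟨P, hP, hdis⟩ := menger_arcs (arcSet E) (suffixSet σ b) (prefixSet σ a)
      (Finset.disjoint_left.mpr fun u hu hu' => by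
        rw [hmems] at hu; rw [hmemp] at hu'; omega) hcut
    refine ⟨P, fun i => ?_, hdis⟩
    obtain ⟨⟨s, hs, hs'⟩, ⟨t, ht, ht'⟩, harc⟩ := hP i
    exact ⟨s, hs, t, ht, hs', ht', isChain_of_pathArcs E _ fun e he =>
      (Finset.mem_filter.mp (harc e he)).2⟩
  · rintro d ⟨P, hP, hdis⟩
    apply Finset.le_inf'
    intro i hi
    rw [Finset.mem_Icc] at hi
    have hc : ∀ j, ∃ e ∈ pathArcs (P j), e ∈ cutFinset E σ i := by
      intro j
      obtain ⟨s, hs, t, ht, hp⟩ := hP j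
      rw [hmems] at hs
      rw [hmemp] at ht
      obtain ⟨e, he, h1, h2, h3⟩ := exists_crossing E (prefixSet σ i) (P j) s t hp
        (by rw [hmemp]; omega) (by rw [hmemp]; omega)
      rw [hmemp] at h2 h3
      exact ⟨e, he, by simp [cutFinset, h1, h3, not_lt.mp h2]⟩
    choose g hg1 hg2 using hc
    have := Finset.card_le_card_of_injOn (s := (Finset.univ : Finset (Fin d)))
      (t := cutFinset E σ i) g (fun j _ => hg2 j) (by
        intro j _ l _ hjl
        by_contra hne
        exact hdis j l hne _ (hg1 j) (hjl ▸ hg1 l))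
    simpa [cutSize] using this
end

section
/- Let D be a semi-complete digraph on n vertices and let c be a positive integer with ctw(D) ≤ 2c. Then there exist an integer ℓ ≤ n and induced subdigraphs D_1, …, D_ℓ of D, each with at most 24c² + 40c + 1 vertices, such that ctw(D) ≤ c if and only if ctw(D_i) ≤ c for every i ∈ {1,…,ℓ}. -/
open Finset

variable {V : Type*} [Fintype V] [DecidableEq V]

/-- The cutwidth of the subdigraph induced by a set `X` of vertices. -/
noncomputable def cutwidthOn (E : V → V → Prop) [inst : DecidableRel E] (X : Finset V) : ℕ :=
  letI : DecidableRel (fun a b : {x // x ∈ X} => E a.1 b.1) := fun a b => inst a.1 b.1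
  cutwidth (fun a b : {x // x ∈ X} => E a.1 b.1)

/-- arcs of `D[W]` from outside `P` into `P` -/
def dcutSet (E : V → V → Prop) [DecidableRel E] (W P : Finset V) : Finset (V × V) :=
  Finset.univ.filter (fun p : V × V => E p.1 p.2 ∧ p.1 ∈ W ∧ p.2 ∈ W ∧ p.1 ∉ P ∧ p.2 ∈ P)

def dcut (E : V → V → Prop) [DecidableRel E] (W P : Finset V) : ℕ := (dcutSet E W P).card

theorem dcut_congr (E : V → V → Prop) [DecidableRel E] (W P Q : Finset V)
    (h : ∀ x ∈ W, x ∈ P ↔ x ∈ Q) : dcut E W P = dcut E W Q := by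
  unfold dcut
  congr 1
  ext ⟨x, y⟩
  simp only [dcutSet, mem_filter, mem_univ, true_and]
  grind

theorem dcut_submod (E : V → V → Prop) [DecidableRel E] (W P Q : Finset V) :
    dcut E W (P ∩ Q) + dcut E W (P ∪ Q) ≤ dcut E W P + dcut E W Q := by
  unfold dcut
  rw [← card_union_add_card_inter, ← card_union_add_card_inter (dcutSet E W P)]
  apply Nat.add_le_add
  · apply card_le_card
    intro ⟨x, y⟩
    simp only [dcutSet, mem_filter, mem_univ, true_and, mem_union, mem_inter]
    grind
  · apply card_le_card
    intro ⟨x, y⟩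
    simp only [dcutSet, mem_filter, mem_univ, true_and, mem_union, mem_inter]
    grind

theorem exists_ord {V : Type*} [Fintype V] [DecidableEq V] (E : V → V → Prop) [DecidableRel E]
    (c : ℕ) (h : cutwidth E ≤ c) :
    ∃ π : V ≃ Fin (Fintype.card V), ∀ i, cutSize E π i ≤ c := by
  have hne : {w | ∃ π : V ≃ Fin (Fintype.card V), widthOf E π = w}.Nonempty :=
    ⟨_, Fintype.equivFin V, rfl⟩
  obtain ⟨π, hπ⟩ := Nat.sInf_mem hne
  refine ⟨π, fun i => ?_⟩
  by_cases hi : i ≤ Fintype.card V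
  · have h1 : cutSize E π i ≤ widthOf E π :=
      Finset.le_sup (f := cutSize E π) (by simp; omega)
    have h2 : widthOf E π ≤ c := by rw [hπ]; exact h
    omega
  · have : cutFinset E π i = ∅ := by
      unfold cutFinset
      ext ⟨x, y⟩
      simp only [mem_filter, mem_univ, true_and, notMem_empty, iff_false]
      have := (π x).2
      omega
    simp [cutSize, this]

theorem cutwidth_le_of_ord (E : V → V → Prop) [DecidableRel E]
    (c : ℕ) (π : V ≃ Fin (Fintype.card V)) (h : ∀ i, cutSize E π i ≤ c) : cutwidth E ≤ c := by
  refine le_trans (Nat.sInf_le ⟨π, rfl⟩) ?_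
  exact Finset.sup_le (fun i _ => h i)

/-- the prefixes of an ordering of `D[W]` -/
theorem sub_chain (E : V → V → Prop) [DecidableRel E] (c : ℕ) (W : Finset V)
    (h : cutwidthOn E W ≤ c) :
    ∃ f : ℕ → Finset V, f 0 = ∅ ∧ f W.card = W ∧ (∀ i, f i ⊆ W) ∧
      (∀ i, i ≤ W.card → (f i).card = i) ∧ (∀ i, f i ⊆ f (i + 1)) ∧ ∀ i, dcut E W (f i) ≤ c := by
  unfold cutwidthOn at h
  obtain ⟨π, hπ⟩ := @exists_ord _ _ _ _ (_) c h
  have hc : Fintype.card {x // x ∈ W} = W.card := by simp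
  refine ⟨fun i => (univ.filter (fun x : {x // x ∈ W} => (π x : ℕ) < i)).map
    (Function.Embedding.subtype _), ?_, ?_, ?_, ?_, ?_, ?_⟩
  · simp
  · ext x
    simp only [mem_map, mem_filter, mem_univ, true_and, Function.Embedding.subtype_apply,
      Subtype.exists, exists_and_right, exists_eq_right]
    constructor
    · rintro ⟨hx, _⟩; exact hx
    · intro hx
      refine ⟨hx, ?_⟩
      have := (π ⟨x, hx⟩).2
      omega
  · intro i x
    simp only [mem_map, mem_filter, mem_univ, true_and, Function.Embedding.subtype_apply,
      Subtype.exists, exists_and_right, exists_eq_right]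
    rintro ⟨hx, _⟩; exact hx
  · intro i hi
    rw [card_map]
    have : (univ.filter (fun x : {x // x ∈ W} => (π x : ℕ) < i)).card
        = (univ.filter (fun x : Fin (Fintype.card {x // x ∈ W}) => (x : ℕ) < i)).card := by
      apply card_equiv π
      simp
    rw [this, Fin.card_filter_val_lt]
    omega
  · intro i x
    simp only [mem_map, mem_filter, mem_univ, true_and, Function.Embedding.subtype_apply,
      Subtype.exists, exists_and_right, exists_eq_right]
    rintro ⟨hx, h1⟩; exact ⟨hx, by omega⟩
  · intro i
    refine le_trans ?_ (hπ i)
    unfold dcut cutSize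
    rw [← card_map ((Function.Embedding.subtype (fun x => x ∈ W)).prodMap
      (Function.Embedding.subtype (fun x => x ∈ W)))]
    apply card_le_card
    rintro ⟨x, y⟩
    simp only [dcutSet, cutFinset, mem_map, mem_filter, mem_univ, true_and,
      Function.Embedding.subtype_apply,
      Subtype.exists, exists_and_right, exists_eq_right, Prod.exists]
    rintro ⟨h1, hx, hy, h2, ⟨_, h3⟩⟩
    refine ⟨x, hx, y, hy, ⟨h1, ?_, h3⟩, rfl⟩
    by_contra h4
    exact h2 ⟨hx, by omega⟩

/-- one vertex is added, the new set has a small cut -/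
def CStep (E : V → V → Prop) [DecidableRel E] (c : ℕ) (A B : Finset V) : Prop :=
  ∃ v, v ∉ A ∧ B = insert v A ∧ dcut E univ B ≤ c

theorem reach_pos (E : V → V → Prop) [DecidableRel E] (c : ℕ) (A : Finset V)
    (h : Relation.ReflTransGen (CStep E c) ∅ A) :
    ∃ pos : V → ℕ, Set.InjOn pos A ∧ (∀ v ∈ A, pos v < A.card) ∧
      ∀ i, dcut E univ (A.filter (fun v => pos v < i)) ≤ c := by
  induction h with
  | refl => exact ⟨fun _ => 0, by simp, by simp, by simp [dcut, dcutSet]⟩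
  | @tail A B _ hs ih =>
    obtain ⟨pos, h1, h2, h3⟩ := ih
    obtain ⟨v, hv, rfl, hd⟩ := hs
    refine ⟨fun x => if x = v then A.card else pos x, ?_, ?_, ?_⟩
    · intro x hx y hy hxy
      simp only [coe_insert, Set.mem_insert_iff, mem_coe] at hx hy
      have := @h1 x
      have := @h1 y
      simp only [mem_coe] at *
      grind
    · intro x hx
      rw [card_insert_of_notMem hv]
      grind
    · intro i
      by_cases hi : A.card < i
      · have : (insert v A).filter (fun x => (if x = v then A.card else pos x) < i)
            = insert v A := by
          ext x
          have := h2 x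
          simp only [mem_filter, mem_insert]
          grind
        rw [this]; exact hd
      · have : (insert v A).filter (fun x => (if x = v then A.card else pos x) < i)
            = A.filter (fun x => pos x < i) := by
          ext x
          simp only [mem_filter, mem_insert]
          grind
        rw [this]; exact h3 i

theorem cutwidth_le_of_reach (E : V → V → Prop) [DecidableRel E] (c : ℕ)
    (h : Relation.ReflTransGen (CStep E c) ∅ (univ : Finset V)) : cutwidth E ≤ c := by
  obtain ⟨pos, h1, h2, h3⟩ := reach_pos E c _ h
  have hb : Function.Bijective
      (fun v : V => (⟨pos v, h2 v (mem_univ v)⟩ : Fin (Fintype.card V))) := by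
    rw [Fintype.bijective_iff_injective_and_card]
    refine ⟨fun x y hxy => ?_, by simp⟩
    exact h1 (by simp) (by simp) (congrArg Fin.val hxy)
  refine cutwidth_le_of_ord E c (Equiv.ofBijective _ hb) (fun i => ?_)
  refine le_trans (card_le_card ?_) (h3 i)
  rintro ⟨x, y⟩
  simp only [cutFinset, dcutSet, mem_filter, mem_univ, true_and, Equiv.ofBijective_apply]
  rintro ⟨a, b, d⟩
  exact ⟨a, by omega, d⟩

section window

variable (E : V → V → Prop) [DecidableRel E] (σ : V ≃ Fin (Fintype.card V)) (c : ℕ)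

theorem near (hsc : ∀ u v : V, u ≠ v → E u v ∨ E v u) (hc : 0 < c)
    (hσ : ∀ i, cutSize E σ i ≤ 2 * c) (W P : Finset V) (hP : dcut E W P ≤ c)
    (m t : ℕ) (hW : ∀ w, m ≤ (σ w : ℕ) → (σ w : ℕ) < t → w ∈ W) (hmt : m + 6 * c ≤ t)
    (u v : V) (hu : u ∈ W) (huP : u ∉ P) (hum : (σ u : ℕ) < m)
    (hv : v ∈ W) (hvP : v ∈ P) (hvt : t ≤ (σ v : ℕ)) : False := by
  classical
  set S : Finset V := univ.filter (fun w => m ≤ (σ w : ℕ) ∧ (σ w : ℕ) < t) with hS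
  have hScard : S.card = t - m := by
    have h1 : S.card = ((univ : Finset (Fin (Fintype.card V))).filter
        (fun x : Fin (Fintype.card V) => m ≤ (x : ℕ) ∧ (x : ℕ) < t)).card := by
      apply card_equiv σ
      simp [hS]
    rw [h1, ← card_map Fin.valEmbedding, ← Nat.card_Ico]
    congr 1
    ext x
    simp only [mem_map, mem_filter, mem_univ, true_and, Fin.valEmbedding_apply, mem_Ico]
    constructor
    · rintro ⟨y, hy, rfl⟩; exact hy
    · intro hx
      have := (σ v).2
      exact ⟨⟨x, by omega⟩, hx, rfl⟩
  have h5 : (dcutSet E W P ∪ cutFinset E σ m ∪ cutFinset E σ t).card ≤ 5 * c := by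
    have a1 := card_union_le (dcutSet E W P ∪ cutFinset E σ m) (cutFinset E σ t)
    have a2 := card_union_le (dcutSet E W P) (cutFinset E σ m)
    have a3 := hσ m
    have a4 := hσ t
    unfold cutSize at a3 a4
    unfold dcut at hP
    omega
  have h6 : S.card ≤ (dcutSet E W P ∪ cutFinset E σ m ∪ cutFinset E σ t).card := by
    apply card_le_card_of_injOn (fun w => if w ∈ P then (if E u w then (u, w) else (w, u))
      else (if E w v then (w, v) else (v, w)))
    · intro w hw
      simp only [hS, coe_filter, mem_univ, true_and, Set.mem_ofPred_eq] at hw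
      have hwW := hW w hw.1 hw.2
      have hwu : w ≠ u := by rintro rfl; omega
      have hwv : w ≠ v := by rintro rfl; omega
      have e1 := hsc w u hwu
      have e2 := hsc w v hwv
      simp only [coe_union, Set.mem_union, mem_coe, dcutSet, cutFinset, mem_filter, mem_univ,
        true_and]
      by_cases p1 : w ∈ P
      · by_cases p2 : E u w
        · simp only [p1, p2, if_true]
          left; left
          exact ⟨trivial, hu, hwW, huP, trivial⟩
        · simp only [p1, p2, if_true, if_false]
          left; right
          exact ⟨by tauto, hw.1, hum⟩
      · by_cases p2 : E w v
        · simp only [p1, p2, if_true, if_false]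
          left; left
          exact ⟨trivial, hwW, hv, not_false, hvP⟩
        · simp only [p1, p2, if_false]
          right
          exact ⟨by tauto, hvt, hw.2⟩
    · intro w hw w' hw' heq
      simp only [hS, coe_filter, mem_univ, true_and, Set.mem_ofPred_eq] at hw hw'
      have hwu : w ≠ u := by rintro rfl; omega
      have hwv : w ≠ v := by rintro rfl; omega
      have hwu' : w' ≠ u := by rintro rfl; omega
      have hwv' : w' ≠ v := by rintro rfl; omega
      dsimp only at heq
      split_ifs at heq <;> simp only [Prod.mk.injEq] at heq <;> grind
  omega

/-- the window of `σ` between `a` and `b` with the ends of the long backward arcs -/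
def win (a b : ℕ) : Finset V :=
  univ.filter (fun v => a ≤ (σ v : ℕ) ∧ (σ v : ℕ) < b) ∪
    ((cutFinset E σ a).image Prod.snd ∪ (cutFinset E σ b).image Prod.fst)

theorem mem_win {a b : ℕ} {w : V} (h1 : a ≤ (σ w : ℕ)) (h2 : (σ w : ℕ) < b) :
    w ∈ win E σ a b := by
  simp [win, h1, h2]

theorem win_card (hσ : ∀ i, cutSize E σ i ≤ 2 * c) (a b : ℕ) :
    (win E σ a b).card ≤ (b - a) + 4 * c := by
  have h1 : (univ.filter (fun v => a ≤ (σ v : ℕ) ∧ (σ v : ℕ) < b)).card ≤ b - a := by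
    rw [← Nat.card_Ico]
    apply card_le_card_of_injOn (fun v => (σ v : ℕ))
    · intro x hx
      simpa using hx
    · intro x _ y _ hxy
      exact σ.injective (Fin.ext hxy)
  have h2 := card_union_le (univ.filter (fun v => a ≤ (σ v : ℕ) ∧ (σ v : ℕ) < b))
    ((cutFinset E σ a).image Prod.snd ∪ (cutFinset E σ b).image Prod.fst)
  have h3 := card_union_le ((cutFinset E σ a).image Prod.snd) ((cutFinset E σ b).image Prod.fst)
  have h4 : ((cutFinset E σ a).image Prod.snd).card ≤ (cutFinset E σ a).card := card_image_le
  have h5 : ((cutFinset E σ b).image Prod.fst).card ≤ (cutFinset E σ b).card := card_image_le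
  have h6 := hσ a
  have h7 := hσ b
  unfold cutSize at h6 h7
  unfold win
  omega

theorem win_dcut (a b : ℕ) (Y : Finset V)
    (h1 : prefixSet σ a ⊆ Y) (h2 : Y ⊆ prefixSet σ b) :
    dcut E univ Y = dcut E (win E σ a b) Y := by
  unfold dcut
  congr 1
  ext ⟨x, y⟩
  simp only [dcutSet, mem_filter, mem_univ, true_and]
  constructor
  · rintro ⟨hE, hx, hy⟩
    have hx' : a ≤ (σ x : ℕ) := by
      by_contra hlt
      exact hx (h1 (by simp [prefixSet]; omega))
    have hy' : (σ y : ℕ) < b := by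
      have := h2 hy
      simpa [prefixSet] using this
    refine ⟨hE, ?_, ?_, hx, hy⟩
    · by_cases hb : (σ x : ℕ) < b
      · exact mem_win E σ hx' hb
      · unfold win
        simp only [mem_union, mem_image, cutFinset, mem_filter, mem_univ, true_and]
        right; right
        exact ⟨(x, y), ⟨hE, by simpa using hb, hy'⟩, rfl⟩
    · by_cases ha : a ≤ (σ y : ℕ)
      · exact mem_win E σ ha hy'
      · unfold win
        simp only [mem_union, mem_image, cutFinset, mem_filter, mem_univ, true_and]
        right; left
        exact ⟨(x, y), ⟨hE, hx', by simpa using ha⟩, rfl⟩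
  · rintro ⟨hE, _, _, hx, hy⟩
    exact ⟨hE, hx, hy⟩

theorem mem_prefixSet {i : ℕ} {v : V} : v ∈ prefixSet σ i ↔ (σ v : ℕ) < i := by
  simp [prefixSet]

theorem prefixSet_mono {i j : ℕ} (h : i ≤ j) : prefixSet σ i ⊆ prefixSet σ j := by
  intro v
  simp only [mem_prefixSet]
  omega

theorem start_cut (hsc : ∀ u v : V, u ≠ v → E u v ∨ E v u) (hc : 0 < c)
    (hσ : ∀ i, cutSize E σ i ≤ 2 * c)
    (hall : ∀ W : Finset V, W.card ≤ 24 * c ^ 2 + 40 * c → cutwidthOn E W ≤ c) (p : ℕ) :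
    ∃ Y, prefixSet σ (p - 6 * c) ⊆ Y ∧ Y ⊆ prefixSet σ (p + 6 * c) ∧ dcut E univ Y ≤ c := by
  set W := win E σ (p - 6 * c) (p + 6 * c) with hWdef
  have hW : W.card ≤ 24 * c ^ 2 + 40 * c := by
    have := win_card E σ c hσ (p - 6 * c) (p + 6 * c)
    rw [← hWdef] at this
    nlinarith [this, Nat.zero_le (c ^ 2), (by omega : p + 6 * c - (p - 6 * c) ≤ 12 * c)]
  obtain ⟨f, -, -, hfW, hfc, -, hfd⟩ := sub_chain E c W (hall W hW)
  set q := (W ∩ prefixSet σ p).card with hq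
  have hqW : q ≤ W.card := card_le_card inter_subset_left
  set P := f q with hPdef
  have hPc : P.card = q := hfc q hqW
  have hPd : dcut E W P ≤ c := hfd q
  have hPW : P ⊆ W := hfW q
  have hP1 : P ⊆ prefixSet σ (p + 6 * c) := by
    intro v hv
    by_contra hvt
    rw [mem_prefixSet] at hvt
    have hsub : W ∩ prefixSet σ p ⊆ P.erase v := by
      intro u hu
      rw [mem_inter, mem_prefixSet] at hu
      rw [mem_erase]
      refine ⟨by rintro rfl; omega, ?_⟩
      by_contra huP
      refine near E σ c hsc hc hσ W P hPd p (p + 6 * c) ?_ le_rfl u v hu.1 huP hu.2 (hPW hv) hv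
        (by omega)
      intro w h1 h2
      exact mem_win E σ (by omega) h2
    have h1 := card_le_card hsub
    rw [card_erase_of_mem hv] at h1
    have h2 : 0 < P.card := card_pos.mpr ⟨v, hv⟩
    omega
  have hP2 : ∀ u ∈ W, (σ u : ℕ) < p - 6 * c → u ∈ P := by
    intro u hu hus
    by_contra huP
    have hsub : P ⊆ (W ∩ prefixSet σ p).erase u := by
      intro v hv
      rw [mem_erase, mem_inter, mem_prefixSet]
      refine ⟨by rintro rfl; exact huP hv, hPW hv, ?_⟩
      by_contra hvp
      refine near E σ c hsc hc hσ W P hPd (p - 6 * c) p ?_ (by omega) u v hu huP hus (hPW hv) hv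
        (by omega)
      intro w h1 h2
      exact mem_win E σ h1 (by omega)
    have h1 := card_le_card hsub
    have humem : u ∈ W ∩ prefixSet σ p := by
      rw [mem_inter, mem_prefixSet]; exact ⟨hu, by omega⟩
    rw [card_erase_of_mem humem] at h1
    have h2 : 0 < (W ∩ prefixSet σ p).card := card_pos.mpr ⟨u, humem⟩
    omega
  have hY1 : prefixSet σ (p - 6 * c) ⊆ P ∪ prefixSet σ (p - 6 * c) := subset_union_right
  have hY2 : P ∪ prefixSet σ (p - 6 * c) ⊆ prefixSet σ (p + 6 * c) :=
    union_subset hP1 (prefixSet_mono σ (by omega))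
  refine ⟨P ∪ prefixSet σ (p - 6 * c), hY1, hY2, ?_⟩
  rw [win_dcut E σ _ _ _ hY1 hY2, ← hWdef]
  refine le_trans (le_of_eq (dcut_congr E W _ P ?_)) hPd
  intro x hx
  rw [mem_union, mem_prefixSet]
  have := hP2 x hx
  tauto

/-- `X` is a locally minimum cut between positions `l` and `m`. -/
def LocMin (l m : ℕ) (X : Finset V) : Prop :=
  prefixSet σ l ⊆ X ∧ X ⊆ prefixSet σ m ∧ dcut E univ X ≤ c ∧
    ∀ Y, prefixSet σ (l - 6 * c) ⊆ Y → Y ⊆ prefixSet σ (m + 6 * c) →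
      dcut E univ X ≤ dcut E univ Y

theorem exists_locMin (k : ℕ) : ∀ (l m : ℕ) (Y : Finset V), k ≤ c → dcut E univ Y ≤ k →
    prefixSet σ l ⊆ Y → Y ⊆ prefixSet σ m →
    ∃ l' m' X, l ≤ l' + 6 * c * k ∧ m' ≤ m + 6 * c * k ∧ LocMin E σ c l' m' X := by
  induction k with
  | zero =>
    intro l m Y hk hY h1 h2
    exact ⟨l, m, Y, by omega, by omega, h1, h2, by omega, fun _ _ _ => by omega⟩
  | succ k ih =>
    intro l m Y hk hY h1 h2
    by_cases hmin : ∀ Z, prefixSet σ (l - 6 * c) ⊆ Z → Z ⊆ prefixSet σ (m + 6 * c) →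
      dcut E univ Y ≤ dcut E univ Z
    · exact ⟨l, m, Y, by omega, by omega, h1, h2, by omega, hmin⟩
    · push Not at hmin
      obtain ⟨Z, hZ1, hZ2, hZ3⟩ := hmin
      obtain ⟨l', m', X, a1, a2, a3⟩ := ih _ _ Z (by omega) (by omega) hZ1 hZ2
      refine ⟨l', m', X, ?_, ?_, a3⟩
      · rw [Nat.mul_succ]; omega
      · rw [Nat.mul_succ]; omega

def Good (p : ℕ) (X : Finset V) : Prop :=
  ∃ l m, p ≤ l + (6 * c * c + 6 * c) ∧ m ≤ p + (6 * c * c + 6 * c) ∧ LocMin E σ c l m X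

theorem exists_good (hsc : ∀ u v : V, u ≠ v → E u v ∨ E v u) (hc : 0 < c)
    (hσ : ∀ i, cutSize E σ i ≤ 2 * c)
    (hall : ∀ W : Finset V, W.card ≤ 24 * c ^ 2 + 40 * c → cutwidthOn E W ≤ c) (p : ℕ) :
    ∃ X, Good E σ c p X := by
  obtain ⟨Y, h1, h2, h3⟩ := start_cut E σ c hsc hc hσ hall p
  obtain ⟨l', m', X, a1, a2, a3⟩ := exists_locMin E σ c c _ _ Y le_rfl h3 h1 h2
  exact ⟨X, l', m', by omega, by omega, a3⟩

theorem good_empty : Good E σ c 0 ∅ := by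
  refine ⟨0, 0, by omega, by omega, by simp [prefixSet], by simp, ?_, fun Y _ _ => ?_⟩ <;>
    simp [dcut, dcutSet]

theorem good_univ (p : ℕ) (hp : Fintype.card V ≤ p) : Good E σ c p univ := by
  refine ⟨p, p, by omega, by omega, by simp, ?_, ?_, fun Y _ _ => ?_⟩
  · intro v _
    rw [mem_prefixSet]
    have := (σ v).2
    omega
  · simp [dcut, dcutSet]
  · simp [dcut, dcutSet]

theorem chain_map (f : ℕ → Finset V) (A B : Finset V)
    (hcard : ∀ i, (f i).card ≤ (f (i + 1)).card ∧ (f (i + 1)).card ≤ (f i).card + 1)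
    (hmono : ∀ i, f i ⊆ f (i + 1))
    (hd : ∀ i, dcut E univ ((f i ∩ B) ∪ A) ≤ c) (N : ℕ) :
    Relation.ReflTransGen (CStep E c) ((f 0 ∩ B) ∪ A) ((f N ∩ B) ∪ A) := by
  induction N with
  | zero => exact Relation.ReflTransGen.refl
  | succ N ih =>
    refine ih.trans ?_
    have h1 : (f (N + 1) \ f N).card ≤ 1 := by
      rw [card_sdiff_of_subset (hmono N)]
      have := hcard N
      omega
    by_cases heq : (f (N + 1) ∩ B) ∪ A = (f N ∩ B) ∪ A
    · rw [heq]
    · have hsub : (f N ∩ B) ∪ A ⊆ (f (N + 1) ∩ B) ∪ A :=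
        union_subset_union (inter_subset_inter (hmono N) le_rfl) le_rfl
      obtain ⟨v, hv, hv'⟩ := not_subset.mp (fun h => heq (subset_antisymm h hsub))
      refine Relation.ReflTransGen.single ⟨v, hv', ?_, hd _⟩
      rw [card_le_one] at h1
      have hvm : v ∈ f (N + 1) \ f N := by
        simp only [mem_union, mem_inter, mem_sdiff] at *
        tauto
      ext x
      have hx := h1 x
      have hm := @hmono N x
      simp only [mem_union, mem_inter, mem_insert, mem_sdiff] at *
      constructor
      · intro h
        by_cases hxN : x ∈ f N
        · tauto
        · rcases h with h | h
          · left; exact hx ⟨h.1, hxN⟩ v hvm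
          · tauto
      · rintro (rfl | h)
        · exact hv
        · tauto

theorem good_step (hsc : ∀ u v : V, u ≠ v → E u v ∨ E v u) (hc : 0 < c)
    (hσ : ∀ i, cutSize E σ i ≤ 2 * c)
    (hall : ∀ W : Finset V, W.card ≤ 24 * c ^ 2 + 40 * c → cutwidthOn E W ≤ c) (p : ℕ)
    (X X' : Finset V) (hX : Good E σ c p X)
    (hX' : Good E σ c (p + (12 * c * c + 12 * c)) X') :
    Relation.ReflTransGen (CStep E c) X X' := by
  obtain ⟨l, m, hl, hm, hX1, hX2, hXc, hXmin⟩ := hX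
  obtain ⟨l', m', hl', hm', hX1', hX2', hXc', hXmin'⟩ := hX'
  obtain ⟨k, hk⟩ : ∃ k, k = c * c := ⟨_, rfl⟩
  simp only [mul_assoc] at hl hm hl' hm'
  rw [← hk] at hl hm hl' hm'
  set a := p - (6 * k + 12 * c) with ha
  set b := p + (18 * k + 24 * c) with hb
  set W := win E σ a b with hWdef
  have hW : W.card ≤ 24 * c ^ 2 + 40 * c := by
    have := win_card E σ c hσ a b
    rw [← hWdef] at this
    rw [sq, ← hk]
    omega
  have hXX : X ⊆ X' := hX2.trans ((prefixSet_mono σ (by omega)).trans hX1')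
  have hdW : ∀ Y, prefixSet σ a ⊆ Y → Y ⊆ prefixSet σ b → dcut E univ Y = dcut E W Y :=
    fun Y h1 h2 => win_dcut E σ a b Y h1 h2
  have haX : prefixSet σ a ⊆ X := (prefixSet_mono σ (by omega)).trans hX1
  have hbX' : X' ⊆ prefixSet σ b := hX2'.trans (prefixSet_mono σ (by omega))
  have hX'W : dcut E W X' ≤ c := by rw [← hdW X' (haX.trans hXX) hbX']; exact hXc'
  have hXW : dcut E W X ≤ c := by rw [← hdW X haX (hXX.trans hbX')]; exact hXc
  have key : ∀ P, P ⊆ W → dcut E W P ≤ c → dcut E univ ((P ∩ X') ∪ X) ≤ c := by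
    intro P hPW hP
    have hQ : dcut E W (P ∩ X') ≤ c := by
      by_cases hcase : P ⊆ prefixSet σ (m' + 6 * c)
      · have h1 := dcut_submod E W P X'
        have h2 : P ∪ X' ⊆ prefixSet σ (m' + 6 * c) :=
          union_subset hcase (hX2'.trans (prefixSet_mono σ (by omega)))
        have h3 := hXmin' (P ∪ X')
          (((prefixSet_mono σ (by omega)).trans hX1').trans subset_union_right) h2
        rw [hdW X' (haX.trans hXX) hbX', hdW (P ∪ X')
          ((haX.trans hXX).trans subset_union_right)
          (h2.trans (prefixSet_mono σ (by omega)))] at h3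
        omega
      · obtain ⟨v, hv, hv'⟩ := not_subset.mp hcase
        rw [mem_prefixSet] at hv'
        refine le_trans (le_of_eq (dcut_congr E W _ X' ?_)) hX'W
        intro u hu
        rw [mem_inter]
        refine ⟨fun h => h.2, fun h => ⟨?_, h⟩⟩
        by_contra huP
        have hum := hX2' h
        rw [mem_prefixSet] at hum
        refine near E σ c hsc hc hσ W P hP m' (m' + 6 * c) ?_ le_rfl u v hu huP hum (hPW hv) hv
          (by omega)
        intro w h1 h2
        by_cases hlm : a ≤ m'
        · exact mem_win E σ (by omega) (by omega)
        · exfalso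
          have hw' : w ∈ prefixSet σ m' := by
            by_contra hwm
            have hall' : (σ w : ℕ) < l' → w ∈ prefixSet σ m' := fun h =>
              hX2' (hX1' (by rw [mem_prefixSet]; exact h))
            by_cases hwl : (σ w : ℕ) < l'
            · exact hwm (hall' hwl)
            · omega
          rw [mem_prefixSet] at hw'
          omega
    have hQW : P ∩ X' ⊆ W := inter_subset_left.trans hPW
    have hY1 : prefixSet σ a ⊆ (P ∩ X') ∪ X := haX.trans subset_union_right
    have hY2 : (P ∩ X') ∪ X ⊆ prefixSet σ b :=
      union_subset (inter_subset_right.trans hbX') (hXX.trans hbX')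
    rw [hdW _ hY1 hY2]
    by_cases hcase : ∀ u ∈ W, (σ u : ℕ) < l - 6 * c → u ∈ P ∩ X'
    · have h1 := dcut_submod E W (P ∩ X') X
      have hZ1 : prefixSet σ (l - 6 * c) ⊆ ((P ∩ X') ∩ X) ∪ prefixSet σ (l - 6 * c) :=
        subset_union_right
      have hZX : ((P ∩ X') ∩ X) ∪ prefixSet σ (l - 6 * c) ⊆ X :=
        union_subset inter_subset_right ((prefixSet_mono σ (by omega)).trans hX1)
      have h3 := hXmin _ hZ1 (hZX.trans (hX2.trans (prefixSet_mono σ (by omega))))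
      rw [hdW X haX (hXX.trans hbX'), hdW _ ((prefixSet_mono σ (by omega)).trans hZ1)
        (hZX.trans (hXX.trans hbX'))] at h3
      have h4 : dcut E W (((P ∩ X') ∩ X) ∪ prefixSet σ (l - 6 * c))
          = dcut E W ((P ∩ X') ∩ X) := by
        apply dcut_congr
        intro x hx
        have h5 := hcase x hx
        have h6 : x ∈ prefixSet σ (l - 6 * c) → x ∈ X := fun h => hZX (hZ1 h)
        rw [mem_union, mem_inter]
        rw [mem_prefixSet] at *
        tauto
      omega
    · push Not at hcase
      obtain ⟨u, hu, hus, huQ⟩ := hcase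
      have hQX : P ∩ X' ⊆ X := by
        intro v hv
        apply hX1
        rw [mem_prefixSet]
        by_contra hvl
        refine near E σ c hsc hc hσ W (P ∩ X') hQ (l - 6 * c) l ?_ (by omega) u v hu huQ hus
          (hQW hv) hv (by omega)
        intro w h1 h2
        by_cases hlb : l ≤ b
        · exact mem_win E σ (by omega) (by omega)
        · exfalso
          have h3 := hX2 (hX1 (by rw [mem_prefixSet]; exact h2 : w ∈ prefixSet σ l))
          have h4 := hbX' (mem_inter.mp hv).2
          rw [mem_prefixSet] at h3 h4
          omega
      rw [union_eq_right.mpr hQX]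
      exact hXW
  obtain ⟨f, hf0, hfN, hfW, hfc, hfm, hfd⟩ := sub_chain E c W (hall W hW)
  have hcard : ∀ i, (f i).card ≤ (f (i + 1)).card ∧ (f (i + 1)).card ≤ (f i).card + 1 := by
    intro i
    refine ⟨card_le_card (hfm i), ?_⟩
    by_cases hi : i + 1 ≤ W.card
    · rw [hfc _ hi, hfc i (by omega)]
    · have hmono : Monotone f := monotone_nat_of_le_succ hfm
      have h1 : W ⊆ f i := by
        have := hmono (by omega : W.card ≤ i)
        rw [hfN] at this
        exact this
      have := card_le_card ((hfW (i + 1)).trans h1)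
      omega
  have hres := chain_map E c f X X' hcard hfm (fun i => key (f i) (hfW i) (hfd i)) W.card
  rw [hf0, hfN, empty_inter, empty_union] at hres
  have hend : W ∩ X' ∪ X = X' := by
    apply subset_antisymm (union_subset inter_subset_right hXX)
    intro x hx
    rw [mem_union, mem_inter]
    by_cases hxX : x ∈ X
    · exact Or.inr hxX
    · left
      refine ⟨?_, hx⟩
      have h1 := hbX' hx
      rw [mem_prefixSet] at h1
      refine mem_win E σ ?_ h1
      by_contra hlt
      exact hxX (haX (by rw [mem_prefixSet]; omega))
  rw [hend] at hres
  exact hres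

theorem small_suffice (hsc : ∀ u v : V, u ≠ v → E u v ∨ E v u) (hc : 0 < c)
    (hctw : cutwidth E ≤ 2 * c)
    (hall : ∀ W : Finset V, W.card ≤ 24 * c ^ 2 + 40 * c → cutwidthOn E W ≤ c) :
    cutwidth E ≤ c := by
  obtain ⟨σ, hσ⟩ := exists_ord E (2 * c) hctw
  apply cutwidth_le_of_reach
  have main : ∀ j : ℕ, ∃ X, Good E σ c (j * (12 * c * c + 12 * c)) X ∧
      Relation.ReflTransGen (CStep E c) ∅ X := by
    intro j
    induction j with
    | zero => exact ⟨∅, by rw [zero_mul]; exact good_empty E σ c, Relation.ReflTransGen.refl⟩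
    | succ j ih =>
      obtain ⟨X, h1, h2⟩ := ih
      obtain ⟨X', h3⟩ := exists_good E σ c hsc hc hσ hall ((j + 1) * (12 * c * c + 12 * c))
      refine ⟨X', h3, h2.trans ?_⟩
      rw [Nat.succ_mul] at h3
      exact good_step E σ c hsc hc hσ hall _ X X' h1 h3
  obtain ⟨X, h1, h2⟩ := main (Fintype.card V)
  refine h2.trans (good_step E σ c hsc hc hσ hall _ X univ h1 (good_univ E σ c _ ?_))
  have : 1 ≤ 12 * c * c + 12 * c := by omega
  nlinarith

end window

/-- Let `D` be a semi-complete digraph on `n` vertices and `c` a positive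
integer with `ctw(D) ≤ 2c`. Then there are `ℓ ≤ n` induced subdigraphs `D_1, …, D_ℓ` of `D`,
each on at most `24c² + 40c + 1` vertices, such that `ctw(D) ≤ c` iff `ctw(D_i) ≤ c` for
all `i`. -/
theorem turing_kernel_decomposition (E : V → V → Prop) [DecidableRel E]
    (hirr : ∀ v : V, ¬ E v v)
    (hsc : ∀ u v : V, u ≠ v → E u v ∨ E v u)
    (c : ℕ) (hc : 0 < c) (hctw : cutwidth E ≤ 2 * c) :
    ∃ ℓ : ℕ, ℓ ≤ Fintype.card V ∧
      ∃ A : Fin ℓ → Finset V,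
        (∀ i, (A i).card ≤ 24 * c ^ 2 + 40 * c + 1) ∧
        (cutwidth E ≤ c ↔ ∀ i, cutwidthOn E (A i) ≤ c) := by
  classical
  by_cases hle : cutwidth E ≤ c
  · exact ⟨0, Nat.zero_le _, fun i => i.elim0, fun i => i.elim0,
      ⟨fun _ i => i.elim0, fun _ => hle⟩⟩
  · have hex : ∃ W : Finset V, W.card ≤ 24 * c ^ 2 + 40 * c ∧ ¬ cutwidthOn E W ≤ c := by
      by_contra hno
      push Not at hno
      exact hle (small_suffice E c hsc hc hctw hno)
    obtain ⟨W, hW, hWc⟩ := hex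
    have hpos : 1 ≤ Fintype.card V := by
      by_contra h0
      apply hle
      have hV : IsEmpty V := Fintype.card_eq_zero_iff.mp (by omega)
      obtain ⟨π, -⟩ := exists_ord E (2 * c) hctw
      refine cutwidth_le_of_ord E c π (fun i => ?_)
      have h1 : cutFinset E π i = ∅ := by
        ext p
        exact (hV.false p.1).elim
      simp [cutSize, h1]
    exact ⟨1, hpos, fun _ => W, fun _ => le_trans hW (Nat.le_succ _),
      ⟨fun h => (hle h).elim, fun h => (hWc (h 0)).elim⟩⟩
end

section
/- For every nonnegative integer c, every c-cutwidth-minimal tournament has at most 2c + 2⌈√(2c)⌉ + 1 vertices. -/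
open Finset

variable {V : Type*} [Fintype V] [DecidableEq V]

section helpers

/-- in-degree of `y` from inside `X` -/
def dg (E : V → V → Prop) [DecidableRel E] (X : Finset V) (y : V) : ℕ :=
  (X.filter (fun x => E x y)).card

/-- number of arcs entering `S` from `X \ S` -/
def ct (E : V → V → Prop) [DecidableRel E] (X S : Finset V) : ℕ :=
  ∑ y ∈ S, dg E (X \ S) y

/-- the cutwidth certificate -/
def PP (E : V → V → Prop) [DecidableRel E] (X : Finset V) (c : ℕ) : Prop :=
  ∃ k, k ≤ X.card ∧ ∀ S, S ⊆ X → S.card = k → c ≤ ct E X S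

theorem dg_union (E : V → V → Prop) [DecidableRel E] (X Y : Finset V) (h : Disjoint X Y) (y : V) :
    dg E (X ∪ Y) y = dg E X y + dg E Y y := by
  unfold dg
  rw [filter_union, card_union_of_disjoint (disjoint_filter_filter h)]

theorem dg_split (E : V → V → Prop) [DecidableRel E] (X S : Finset V) (h : S ⊆ X) (y : V) :
    dg E X y = dg E (X \ S) y + dg E S y := by
  rw [← dg_union E _ _ sdiff_disjoint, sdiff_union_of_subset h]

theorem dg_mono (E : V → V → Prop) [DecidableRel E] {X Y : Finset V} (h : X ⊆ Y) (y : V) :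
    dg E X y ≤ dg E Y y := card_le_card (filter_subset_filter _ h)

theorem dg_swap (E : V → V → Prop) [DecidableRel E]
    (htour : ∀ u v : V, u ≠ v → (E u v ↔ ¬ E v u)) (S : Finset V) (v : V) (hv : v ∉ S) :
    dg E S v + (S.filter (fun y => E v y)).card = S.card := by
  have : S.filter (fun y => E v y) = S.filter (fun x => ¬ E x v) := by
    apply filter_congr
    intro x hx
    exact htour v x (by rintro rfl; exact hv hx)
  rw [this]
  exact card_filter_add_card_filter_not _

theorem sum_dg (E : V → V → Prop) [DecidableRel E] (hirr : ∀ v : V, ¬ E v v)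
    (htour : ∀ u v : V, u ≠ v → (E u v ↔ ¬ E v u)) (S : Finset V) :
    ∑ y ∈ S, dg E S y = S.card.choose 2 := by
  induction S using Finset.induction_on with
  | empty => simp
  | insert v S hv ih =>
    have e1 : ∀ y, dg E (insert v S) y = dg E S y + (if E v y then 1 else 0) := by
      intro y
      unfold dg
      rw [filter_insert]
      split_ifs
      · rw [card_insert_of_notMem]
        simp [hv]
      · simp
    rw [sum_insert hv, card_insert_of_notMem hv, e1, if_neg (hirr v),
      Nat.choose_succ_succ' S.card 1, ← ih]
    simp only [e1, sum_add_distrib]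
    have := dg_swap E htour S v hv
    rw [card_filter] at this
    simp only [Nat.choose_one_right]
    omega

theorem ct_add (E : V → V → Prop) [DecidableRel E] (hirr : ∀ v : V, ¬ E v v)
    (htour : ∀ u v : V, u ≠ v → (E u v ↔ ¬ E v u)) (X S : Finset V) (h : S ⊆ X) :
    ct E X S + S.card.choose 2 = ∑ y ∈ S, dg E X y := by
  rw [← sum_dg E hirr htour, ct, ← sum_add_distrib]
  exact sum_congr rfl fun y _ => (dg_split E X S h y).symm

theorem exch (f : V → ℕ) (A S : Finset V) (hc : A.card = S.card)
    (h : ∀ u ∈ A \ S, ∀ v ∈ S \ A, f u ≤ f v) : ∑ y ∈ A, f y ≤ ∑ y ∈ S, f y := by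
  have h1 := sum_sdiff (f := f) (inter_subset_left : A ∩ S ⊆ A)
  have h2 := sum_sdiff (f := f) (inter_subset_right : A ∩ S ⊆ S)
  rw [sdiff_inter_self_left] at h1
  rw [sdiff_inter_self_right] at h2
  have hcc : (A \ S).card = (S \ A).card := card_sdiff_comm hc
  have : ∑ y ∈ A \ S, f y ≤ ∑ y ∈ S \ A, f y := by
    calc ∑ y ∈ A \ S, f y ≤ (A \ S).card • (A \ S).sup f :=
          sum_le_card_nsmul _ _ _ fun x hx => le_sup hx
      _ = (S \ A).card • (A \ S).sup f := by rw [hcc]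
      _ ≤ _ := card_nsmul_le_sum _ _ _ fun x hx => Finset.sup_le fun u hu => h u hu x hx
  omega

theorem sum_dg_eq_card (E : V → V → Prop) [DecidableRel E] (X S : Finset V) :
    ∑ y ∈ S, dg E X y = ((X ×ˢ S).filter (fun p => E p.1 p.2)).card := by
  simp only [dg, card_filter, sum_product_right]

theorem PP_lower (E : V → V → Prop) [DecidableRel E] (X : Finset V) (c : ℕ) (h : PP E X c) :
    c ≤ cutwidthOn E X := by
  obtain ⟨k, hk, h⟩ := h
  unfold cutwidthOn cutwidth
  apply le_csInf
  · exact ⟨_, Fintype.equivFin _, rfl⟩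
  · rintro w ⟨π, rfl⟩
    have hcard : Fintype.card {x // x ∈ X} = X.card := by simp
    refine le_trans ?_ (Finset.le_sup (f := cutSize _ π) (b := k) (by simp; omega))
    set S := (prefixSet π k).map (Function.Embedding.subtype _) with hS
    have hSX : S ⊆ X := by
      intro x hx
      simp only [hS, mem_map] at hx
      obtain ⟨y, _, rfl⟩ := hx
      exact y.2
    have hSc : S.card = k := by
      rw [hS, card_map, prefixSet]
      have : ((univ : Finset (Fin (Fintype.card {x // x ∈ X}))).filter
          (fun i : Fin _ => (i : ℕ) < k)).card = k := by
        rw [Fin.card_filter_val_lt]; omega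
      rw [← this]
      apply card_bij (fun v _ => π v)
      · intro a ha; simpa [this] using ha
      · intro a _ b _ hab; exact π.injective hab
      · intro b hb; exact ⟨π.symm b, by simpa [this] using hb, by simp⟩
    refine (h S hSX hSc).trans ?_
    rw [ct, sum_dg_eq_card]
    unfold cutSize
    refine le_trans (card_le_card (t := (cutFinset _ π k).image (Prod.map Subtype.val Subtype.val)) ?_)
      card_image_le
    rintro ⟨x, y⟩ hxy
    simp only [mem_filter, mem_product, mem_sdiff] at hxy
    obtain ⟨⟨⟨hx, hxS⟩, hyS⟩, hE⟩ := hxy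
    simp only [mem_image]
    refine ⟨(⟨x, hx⟩, ⟨y, hSX hyS⟩), ?_, rfl⟩
    simp only [cutFinset, mem_filter, mem_univ, true_and]
    refine ⟨hE, ?_, ?_⟩
    · by_contra hlt
      exact hxS (by simpa [hS, prefixSet, hx] using hlt)
    · simp only [hS, prefixSet, mem_map] at hyS
      obtain ⟨z, hz, rfl⟩ := hyS
      simpa using hz

theorem PP_upper (E : V → V → Prop) [DecidableRel E] (hirr : ∀ v : V, ¬ E v v)
    (htour : ∀ u v : V, u ≠ v → (E u v ↔ ¬ E v u)) (c : ℕ) (hc : 1 ≤ c)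
    (h : c ≤ cutwidth E) : PP E univ c := by
  let e := Fintype.equivFin V
  let f : Fin (Fintype.card V) → ℕ := fun i => dg E univ (e.symm i)
  let π : V ≃ Fin (Fintype.card V) := e.trans (Tuple.sort f).symm
  have hmono : ∀ u v, π u ≤ π v → dg E univ u ≤ dg E univ v := by
    intro u v huv
    have := Tuple.monotone_sort f huv
    simpa [f, π] using this
  have hw : c ≤ widthOf E π := h.trans (Nat.sInf_le ⟨π, rfl⟩)
  unfold widthOf at hw
  rw [Finset.le_sup_iff (by simpa using (by omega : 0 < c))] at hw
  obtain ⟨k, hk, hck⟩ := hw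
  have hkn : k ≤ Fintype.card V := by simp at hk; omega
  refine ⟨k, by simpa using hkn, ?_⟩
  intro S _ hSc
  have hA : (prefixSet π k).card = k := by
    have : ((univ : Finset (Fin (Fintype.card V))).filter
        (fun i : Fin _ => (i : ℕ) < k)).card = k := by
      rw [Fin.card_filter_val_lt]; omega
    conv_rhs => rw [← this]
    rw [prefixSet]
    apply card_bij (fun v _ => π v)
    · intro a ha; simpa using ha
    · intro a _ b _ hab; exact π.injective hab
    · intro b hb; exact ⟨π.symm b, by simpa using hb, by simp⟩
  have hAS := exch (dg E univ) (prefixSet π k) S (by omega) (by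
    intro u hu v hv
    apply hmono
    simp [prefixSet] at hu hv
    rw [Fin.le_def]
    omega)
  have h1 := ct_add E hirr htour univ S (subset_univ _)
  have h2 := ct_add E hirr htour univ (prefixSet π k) (subset_univ _)
  have h3 : ct E univ (prefixSet π k) = cutSize E π k := by
    rw [ct, sum_dg_eq_card, cutSize]
    congr 1
    ext ⟨x, y⟩
    simp [cutFinset, prefixSet]
    tauto
  rw [hA] at h2
  rw [hSc] at h1
  omega

theorem PP_mono (E : V → V → Prop) [DecidableRel E] (X : Finset V) {c c' : ℕ} (hcc : c ≤ c')
    (h : PP E X c') : PP E X c := by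
  obtain ⟨k, hk, h⟩ := h
  exact ⟨k, hk, fun S h1 h2 => hcc.trans (h S h1 h2)⟩

/-- extending `S` inside `B` so that in-degrees reach the requirement `r`. -/
theorem extend_set (E : V → V → Prop) [DecidableRel E] (B S : Finset V) (hS : S ⊆ B) (r : V → ℕ)
    (hr : ∀ v ∈ S, r v ≤ dg E B v) :
    ∃ b, S ⊆ b ∧ b ⊆ B ∧ b.card ≤ S.card + ∑ v ∈ S, (r v - dg E S v) ∧
      ∀ v ∈ S, r v ≤ dg E b v := by
  have h : ∀ v, ∃ I : Finset V, I ⊆ (B \ S).filter (fun x => E x v) ∧ 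
      (v ∈ S → I.card = r v - dg E S v) ∧ I.card ≤ r v - dg E S v := by
    intro v
    by_cases hv : v ∈ S
    · have h1 := hr v hv
      have h2 := dg_split E B S hS v
      obtain ⟨I, hI, hIc⟩ := exists_subset_card_eq (s := (B \ S).filter (fun x => E x v))
        (n := r v - dg E S v) (by change _ ≤ dg E (B \ S) v; omega)
      exact ⟨I, hI, fun _ => hIc, hIc.le⟩
    · exact ⟨∅, by simp, by simp [hv], by simp⟩
  choose I hI hIc hIl using h
  refine ⟨S ∪ S.biUnion I, subset_union_left, union_subset hS ?_, ?_, ?_⟩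
  · intro x hx
    obtain ⟨v, _, hxv⟩ := mem_biUnion.1 hx
    exact (mem_sdiff.1 (mem_filter.1 (hI v hxv)).1).1
  · refine (card_union_le _ _).trans ?_
    gcongr
    exact card_biUnion_le.trans (sum_le_sum fun v _ => hIl v)
  · intro v hv
    have h1 : dg E (S ∪ I v) v ≤ dg E (S ∪ S.biUnion I) v :=
      dg_mono E (union_subset_union_right (subset_biUnion_of_mem I hv)) v
    have hd : Disjoint S (I v) := by
      rw [disjoint_left]
      intro x hx hxI
      exact (mem_sdiff.1 (mem_filter.1 (hI v hxI)).1).2 hx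
    rw [dg_union E _ _ hd] at h1
    have h2 : dg E (I v) v = (I v).card := by
      rw [dg, filter_true_of_mem]
      intro x hx
      exact (mem_filter.1 (hI v hx)).2
    have := hIc v hv
    omega

/-- degree conditions at an optimal cut -/
theorem opt_cut (E : V → V → Prop) [DecidableRel E] (hirr : ∀ v : V, ¬ E v v)
    (htour : ∀ u v : V, u ≠ v → (E u v ↔ ¬ E v u)) (c : ℕ) (hc : 1 ≤ c)
    (h : PP E univ c) (h' : ¬ PP E univ (c + 1)) :
    ∃ A : Finset V, ct E univ A = c ∧ (∀ u ∈ A, dg E univ u ≤ A.card) ∧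
      (∀ v, v ∉ A → A.card ≤ dg E univ v) := by
  classical
  have hmin := Nat.find_spec h
  have hlt : ∀ m, m < Nat.find h → _ := fun m hm => Nat.find_min h hm
  set k := Nat.find h with hk
  obtain ⟨hkn, hkS⟩ := hmin
  unfold PP at h'
  push Not at h'
  obtain ⟨A, hA, hAk, hAc⟩ := h' k hkn
  have hAc' := hkS A hA hAk
  have hAe : ct E univ A = c := by omega
  have eqn := fun S => ct_add E hirr htour univ S (subset_univ S)
  have hAmin : ∀ S : Finset V, S.card = k → ∑ y ∈ A, dg E univ y ≤ ∑ y ∈ S, dg E univ y := by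
    intro S hS
    have h1 := hkS S (subset_univ _) hS
    have h2 := eqn S
    have h3 := eqn A
    rw [hS] at h2
    rw [hAk] at h3
    omega
  have hAB : ∀ u ∈ A, ∀ v, v ∉ A → dg E univ u ≤ dg E univ v := by
    intro u hu v hv
    have hv' : v ∉ A.erase u := fun hh => hv (mem_of_mem_erase hh)
    have h1 := hAmin (insert v (A.erase u)) (by
      rw [card_insert_of_notMem hv', card_erase_of_mem hu]
      have := card_pos.2 ⟨u, hu⟩
      omega)
    rw [sum_insert hv'] at h1
    have h2 := add_sum_erase A (dg E univ) hu
    omega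
  have hk0 : 1 ≤ k := by
    by_contra hk0
    have : A = ∅ := card_eq_zero.1 (by omega)
    subst this
    simp [ct] at hAe
    omega
  have hkn' : k < (univ : Finset V).card := by
    by_contra hcon
    have : A = univ := eq_univ_of_card A (by simp at hcon hkn; omega)
    subst this
    simp [ct, dg] at hAe
    omega
  refine ⟨A, hAe, ?_, ?_⟩
  · obtain ⟨S, _, hSk, hSc⟩ := h' (k + 1) hkn'
    obtain ⟨v, hvS, hvA⟩ : ∃ v ∈ S, v ∉ A := by
      by_contra hcon
      push Not at hcon
      have := card_le_card hcon
      omega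
    have h1 := hAmin (S.erase v) (by rw [card_erase_of_mem hvS]; omega)
    have h2 := add_sum_erase S (dg E univ) hvS
    have h3 := eqn S
    have h4 := eqn A
    rw [hSk, Nat.choose_succ_succ' k 1, Nat.choose_one_right] at h3
    rw [hAk] at h4
    simp only [Nat.reduceAdd] at h3
    intro u hu
    have := hAB u hu v hvA
    omega
  · have := hlt (k - 1) (by omega)
    push Not at this
    obtain ⟨S, _, hSk, hSc⟩ := this (by omega)
    obtain ⟨u, huA, huS⟩ : ∃ u ∈ A, u ∉ S := by
      by_contra hcon
      push Not at hcon
      have := card_le_card hcon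
      omega
    have h1 := hAmin (insert u S) (by rw [card_insert_of_notMem huS]; omega)
    rw [sum_insert huS] at h1
    have h3 := eqn S
    have h4 := eqn A
    obtain ⟨m, hm⟩ : ∃ m, k = m + 1 := ⟨k - 1, by omega⟩
    rw [hAk, hm, Nat.choose_succ_succ' m 1, Nat.choose_one_right] at h4
    have hSm : S.card = m := by omega
    rw [hSm] at h3
    simp only [Nat.reduceAdd] at h4
    intro v hv
    have := hAB u huA v hv
    omega

/-- the small certificate -/
theorem small_cert (E : V → V → Prop) [DecidableRel E] (hirr : ∀ v : V, ¬ E v v)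
    (htour : ∀ u v : V, u ≠ v → (E u v ↔ ¬ E v u)) (c : ℕ) (hc : 1 ≤ c)
    (h : PP E univ c) (h' : ¬ PP E univ (c + 1)) :
    ∃ X : Finset V, X.card ≤ 2 * c + 1 ∧ PP E X c := by
  classical
  obtain ⟨A, hAc, hA, hB⟩ := opt_cut E hirr htour c hc h h'
  let R : V → V → Prop := fun x y => E y x
  let g : V → ℕ := fun u => dg E (univ \ A) u
  let f : V → ℕ := fun v => dg R A v
  have hg : ∑ u ∈ A, g u = c := hAc
  have hf : ∑ v ∈ univ \ A, f v = c := by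
    rw [← hAc, ct, sum_dg_eq_card, sum_dg_eq_card]
    apply card_bij (fun p _ => (p.2, p.1))
    · rintro ⟨x, y⟩ hp; simp [R] at hp ⊢; tauto
    · rintro ⟨x, y⟩ _ ⟨x', y'⟩ _ hp; simp at hp ⊢; tauto
    · rintro ⟨x, y⟩ hp; refine ⟨(y, x), ?_, rfl⟩; simp [R] at hp ⊢; tauto
  have hswap : ∀ (S : Finset V) v, v ∉ S → dg E S v + dg R S v = S.card :=
    fun S v hv => dg_swap E htour S v hv
  have hswap' : ∀ (S : Finset V) v, v ∈ S → dg E S v + dg R S v + 1 = S.card := by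
    intro S v hv
    have h1 := hswap (S.erase v) v (by simp)
    have e1 : dg E (S.erase v) v = dg E S v := by
      unfold dg; rw [filter_erase, erase_eq_of_notMem]; simp [hirr]
    have e2 : dg R (S.erase v) v = dg R S v := by
      unfold dg; rw [filter_erase, erase_eq_of_notMem]; simp [hirr, R]
    have := card_pos.2 ⟨v, hv⟩
    rw [card_erase_of_mem hv] at h1
    omega
  let SA := A.filter (fun u => 1 ≤ g u)
  let SB := (univ \ A).filter (fun v => 1 ≤ f v)
  have hSAg : ∑ u ∈ SA, g u = c := by
    rw [← hg]
    apply sum_subset (filter_subset _ _)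
    intro x hx hx'
    simp [SA, hx] at hx'
    exact hx'
  have hSBf : ∑ u ∈ SB, f u = c := by
    rw [← hf]
    apply sum_subset (filter_subset _ _)
    intro x hx hx'
    have hx2 : x ∉ A := (mem_sdiff.1 hx).2
    simp [SB, hx2] at hx'
    exact hx'
  obtain ⟨a, hSa, haA, hac, har⟩ := extend_set R A SA (filter_subset _ _) (fun u => g u - 1) (by
    intro u hu
    have huA : u ∈ A := (mem_filter.1 hu).1
    have h1 := hA u huA
    have h2 := dg_split E univ A (subset_univ _) u
    have h3 := hswap' A u huA
    simp only [g]
    omega)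
  obtain ⟨b, hSb, hbB, hbc, hbr⟩ := extend_set E (univ \ A) SB (filter_subset _ _) f (by
    intro v hv
    have hvA : v ∉ A := (mem_sdiff.1 (mem_filter.1 hv).1).2
    have h1 := hB v hvA
    have h2 := dg_split E univ A (subset_univ _) v
    have h3 := hswap A v hvA
    simp only [f]
    omega)
  have hac' : a.card ≤ c := by
    refine hac.trans ?_
    rw [← hSAg, card_eq_sum_ones, ← sum_add_distrib]
    apply sum_le_sum
    intro u hu
    have : 1 ≤ g u := (mem_filter.1 hu).2
    omega
  have hbc' : b.card ≤ c + 1 := by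
    refine hbc.trans ?_
    have hz : (SB.filter (fun v => dg E SB v = 0)).card ≤ 1 := by
      rw [card_le_one]
      intro x hx y hy
      by_contra hxy
      simp only [mem_filter, dg, card_eq_zero, filter_eq_empty_iff] at hx hy
      have h1 := hx.2 hy.1
      have h2 := hy.2 hx.1
      exact h2 ((htour x y hxy).2 h1)
    rw [← hSBf]
    have : SB.card + ∑ v ∈ SB, (f v - dg E SB v) ≤
        ∑ v ∈ SB, f v + (SB.filter (fun v => dg E SB v = 0)).card := by
      rw [card_eq_sum_ones, card_filter, ← sum_add_distrib, ← sum_add_distrib]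
      apply sum_le_sum
      intro v hv
      have : 1 ≤ f v := (mem_filter.1 hv).2
      split_ifs <;> omega
    omega
  have hdab : Disjoint a b := by
    rw [disjoint_left]
    intro x hx hx'
    exact (mem_sdiff.1 (hbB hx')).2 (haA hx)
  have hga : ∀ u ∈ A, dg E b u = g u := by
    intro u hu
    simp only [g, dg]
    congr 1
    apply Subset.antisymm (filter_subset_filter _ hbB)
    intro x hx
    rw [mem_filter] at hx ⊢
    refine ⟨hSb ?_, hx.2⟩
    refine mem_filter.2 ⟨hx.1, ?_⟩
    exact card_pos.2 ⟨u, mem_filter.2 ⟨hu, hx.2⟩⟩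
  have hfb : ∀ v, v ∉ A → dg R a v = f v := by
    intro v hv
    simp only [f, dg]
    congr 1
    apply Subset.antisymm (filter_subset_filter _ haA)
    intro x hx
    rw [mem_filter] at hx ⊢
    refine ⟨hSa ?_, hx.2⟩
    refine mem_filter.2 ⟨hx.1, ?_⟩
    exact card_pos.2 ⟨v, mem_filter.2 ⟨by simpa using hv, hx.2⟩⟩
  have hdega : ∀ u ∈ a, dg E (a ∪ b) u ≤ a.card := by
    intro u hu
    rw [dg_union E _ _ hdab, hga u (haA hu)]
    have h3 := hswap' a u hu
    by_cases h1 : 1 ≤ g u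
    · have := har u (mem_filter.2 ⟨haA hu, h1⟩)
      omega
    · omega
  have hdegb : ∀ v ∈ b, a.card ≤ dg E (a ∪ b) v := by
    intro v hv
    have hvA : v ∉ A := (mem_sdiff.1 (hbB hv)).2
    rw [dg_union E _ _ hdab]
    have h3 := hswap a v (fun hh => hvA (haA hh))
    rw [hfb v hvA] at h3
    by_cases h1 : 1 ≤ f v
    · have := hbr v (mem_filter.2 ⟨hbB hv, h1⟩)
      omega
    · omega
  refine ⟨a ∪ b, ?_, a.card, card_le_card subset_union_left, ?_⟩
  · rw [card_union_of_disjoint hdab]; omega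
  · intro S hS hSc
    have hex := exch (dg E (a ∪ b)) a S hSc.symm (by
      intro u hu v hv
      rw [mem_sdiff] at hu hv
      have hvb : v ∈ b := (mem_union.1 (hS hv.1)).resolve_left hv.2
      exact (hdega u hu.1).trans (hdegb v hvb))
    have h1 := ct_add E hirr htour _ S hS
    have h2 := ct_add E hirr htour (a ∪ b) a subset_union_left
    have h3 : ct E (a ∪ b) a = c := by
      rw [ct, union_sdiff_cancel_left hdab, ← hSAg]
      rw [sum_congr rfl fun u hu => hga u (haA hu)]
      symm
      apply sum_subset hSa
      intro x hx hx'
      simpa [SA, haA hx] using hx'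
    rw [hSc] at h1
    omega

end helpers

/-- For every nonnegative integer `c`, every `c`-cutwidth-minimal
tournament has at most `2c + 2⌈√(2c)⌉ + 1` vertices. -/
theorem cutwidth_minimal_tournament_size (E : V → V → Prop) [DecidableRel E]
    (hirr : ∀ v : V, ¬ E v v)
    (htour : ∀ u v : V, u ≠ v → (E u v ↔ ¬ E v u))
    (c : ℕ)
    (hmin₁ : c ≤ cutwidth E)
    (hmin₂ : ∀ X : Finset V, X ⊂ Finset.univ → cutwidthOn E X < c) :
    Fintype.card V ≤ 2 * c + 2 * ⌈Real.sqrt (2 * (c : ℝ))⌉₊ + 1 := by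
  classical
  have hnP : ∀ X : Finset V, X ⊂ univ → ¬ PP E X c := by
    intro X hX hP
    have := PP_lower E X c hP
    have := hmin₂ X hX
    omega
  rcases Nat.eq_zero_or_pos (Fintype.card V) with h0 | hpos
  · omega
  have hne : Nonempty V := Fintype.card_pos_iff.1 hpos
  have hc : 1 ≤ c := by
    have := hmin₂ ∅ (by rw [Finset.ssubset_univ_iff]; exact univ_nonempty.ne_empty.symm)
    omega
  have hP := PP_upper E hirr htour c hc hmin₁
  have hex : ∃ m, ¬ PP E univ (c + (m + 1)) := by
    by_contra hcon
    push Not at hcon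
    obtain ⟨k, hk, hS⟩ := hcon (Fintype.card V * Fintype.card V)
    obtain ⟨S, hSu, hSk⟩ := exists_subset_card_eq hk
    have h1 := hS S hSu hSk
    have h2 : ct E univ S ≤ Fintype.card V * Fintype.card V := by
      rw [ct, sum_dg_eq_card]
      refine (card_le_univ _).trans ?_
      simp
    omega
  obtain ⟨c', hcc', hP', hnP'⟩ : ∃ c', c ≤ c' ∧ PP E univ c' ∧ ¬ PP E univ (c' + 1) := by
    have h1 := Nat.find_spec hex
    refine ⟨c + Nat.find hex, by omega, ?_, h1⟩
    rcases Nat.eq_zero_or_pos (Nat.find hex) with hz | hz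
    · rw [hz]; exact hP
    · have := Nat.find_min hex (m := Nat.find hex - 1) (by omega)
      rw [not_not] at this
      rwa [Nat.sub_add_cancel hz] at this
  obtain ⟨X, hXc, hX⟩ := small_cert E hirr htour c' (by omega) hP' hnP'
  have hXu : X = univ := by
    by_contra hne
    exact hnP X (Finset.ssubset_univ_iff.2 hne) (PP_mono E X hcc' hX)
  rw [hXu, card_univ] at hXc
  obtain ⟨v, _, hv⟩ := exists_min_image (univ : Finset V) (dg E univ) univ_nonempty
  set δ := dg E univ v with hδ
  have hvu : univ.erase v ⊂ (univ : Finset V) := erase_ssubset (mem_univ v)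
  have hnv := hnP _ hvu
  have hcardv : (univ.erase v : Finset V).card = Fintype.card V - 1 := by
    rw [card_erase_of_mem (mem_univ v), card_univ]
  have hdel : ∀ y, dg E univ y ≤ dg E (univ.erase v) y + 1 := by
    intro y
    have h1 := dg_split E univ {v} (subset_univ _) y
    rw [sdiff_singleton_eq_erase] at h1
    have h2 : dg E {v} y ≤ 1 := (card_filter_le _ _).trans (by simp)
    omega
  have hδn : δ ≤ Fintype.card V - 1 := by
    rw [← hcardv, hδ, dg]
    apply card_le_card
    intro x hx
    rw [mem_filter] at hx
    refine mem_erase.2 ⟨?_, mem_univ _⟩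
    rintro rfl
    exact hirr _ hx.2
  have hsmall : c' < c + δ := by
    by_contra hcon
    obtain ⟨k, hk, hS⟩ := hP'
    apply hnv
    have hk0 : 1 ≤ k := by
      by_contra hk0
      have := hS ∅ (subset_univ _) (by rw [card_empty]; omega)
      simp [ct] at this
      omega
    rw [card_univ] at hk
    refine ⟨k - 1, by omega, ?_⟩
    intro S hSv hSk
    have hvS : v ∉ S := fun hh => by simpa using hSv hh
    have h1 := hS (insert v S) (subset_univ _) (by rw [card_insert_of_notMem hvS]; omega)
    rw [ct, sum_insert hvS] at h1
    have h2 : dg E (univ \ insert v S) v ≤ δ := dg_mono E (subset_univ _) v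
    have h3 : (univ \ insert v S : Finset V) = univ.erase v \ S := by
      ext x; simp
    rw [h3] at h1 h2
    change c' ≤ _ + ct E (univ.erase v) S at h1
    omega
  have hδc : (δ - 1 : ℝ) < Real.sqrt (2 * (c : ℝ)) := by
    obtain ⟨m, hm⟩ : ∃ m, δ = m + 1 := ⟨δ - 1, by omega⟩
    have hlt : (m + 1) * m < 2 * c := by
      by_contra hcon
      apply hnv
      refine ⟨m, by omega, ?_⟩
      intro S hSv hSm
      have h1 := ct_add E hirr htour _ S hSv
      have h2 : S.card • m ≤ ∑ y ∈ S, dg E (univ.erase v) y := by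
        apply card_nsmul_le_sum
        intro y _
        have := hv y (mem_univ y)
        have := hdel y
        omega
      rw [hSm, smul_eq_mul] at h2
      rw [hSm] at h1
      have h3 := Nat.choose_two_right m
      have h4 : m * (m - 1) + m = m * m := by
        cases m with
        | zero => rfl
        | succ j => simp; ring
      have h5 : (m + 1) * m = m * m + m := by ring
      have h6 := Nat.div_mul_le_self (m * (m - 1)) 2
      omega
    rw [hm]
    push_cast
    apply Real.lt_sqrt_of_sq_lt
    have : ((m : ℝ) + 1) * m < 2 * c := by exact_mod_cast hlt
    have hm0 : (0 : ℝ) ≤ m := Nat.cast_nonneg m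
    nlinarith
  have hceil : δ ≤ ⌈Real.sqrt (2 * (c : ℝ))⌉₊ := by
    have h1 := Nat.le_ceil (Real.sqrt (2 * (c : ℝ)))
    have h2 : (δ : ℝ) < ⌈Real.sqrt (2 * (c : ℝ))⌉₊ + 1 := by linarith
    have h3 : δ < ⌈Real.sqrt (2 * (c : ℝ))⌉₊ + 1 := by exact_mod_cast h2
    omega
  omega
end
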